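/- arXiv:2603.28299 — 2 statements merged into one kernel-verified Lean document; each statement's English description precedes it below -/
import Mathlib

section
/- Let a star graph have k incoming bonds b_j=(L_j,0) with L_j<0 (j=1,…,k) and m outgoing bonds b_j=(0,L_j) with L_j>0 (j=k+1,…,k+m), let 0<α<1, let a_1=1 and a_j≠0 for j=2,…,k+m, and let B be a constant real m×k matrix such that BᵀB−I_k is negative definite. Then the initial–boundary value problem consisting of the time-fractional Airy equation D^α_{0,t}u_j(x,t) − ∂³u_j/∂x³(x,t) = f_j(x,t) on each bond for 0<t≤T, the initial conditions u_j(x,0)=u_{0,j}(x), the vertex conditions a_j u_j(0,t)=u_1(0,t) (j=2,…,k+m), ∂_x u⁺(0,t)=B ∂_x u⁻(0,t), Σ_{j=1}^k (1/a_j)∂²_x u_j(0,t) = Σ_{j=k+1}^{k+m} (1/a_j)∂²_x u_j(0,t), and the boundary conditions u_j(L_j,t)=φ_j(t) for all j=1,…,k+m and ∂_x u_j(L_j,t)=ϕ_j(t) for j=1,…,k, has at most one solution: two classical solutions with the same data u_{0,j}, f_j, φ_j, ϕ_j coincide. -/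
open MeasureTheory Real Filter Set Topology

/-- Caputo fractional derivative of order `α` with base point `0`. -/
noncomputable def caputoD (α : ℝ) (g : ℝ → ℝ) (t : ℝ) : ℝ :=
  (1 / Real.Gamma (1 - α)) * ∫ ξ in (0:ℝ)..t, deriv g ξ / (t - ξ) ^ α

/-- Riemann–Liouville fractional integral of order `β` with base point `0`. -/
noncomputable def fracJ (β : ℝ) (g : ℝ → ℝ) (t : ℝ) : ℝ :=
  (1 / Real.Gamma β) * ∫ ξ in (0:ℝ)..t, g ξ * (t - ξ) ^ (β - 1)

/-- The Wright function `φ(λ, μ; z)`. -/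
noncomputable def wrightPhi (l μ z : ℂ) : ℂ :=
  ∑' n : ℕ, z ^ n / ((n.factorial : ℂ) * Complex.Gamma (l * n + μ))

/-- The cube root of unity `e^{2πi/3}`. -/
noncomputable def e23 : ℂ := Complex.exp (2 * Real.pi * Complex.I / 3)

/-- First fundamental solution `G_α^μ(x,t)` of the time-fractional Airy equation. -/
noncomputable def Gfun (α μ : ℝ) (x t : ℝ) : ℝ :=
  if x < 0 then
    (1/3) * t ^ (μ - 1) * (wrightPhi (-(α/3)) μ ((x / t ^ (α/3) : ℝ) : ℂ)).re
  else
    -(2/3) * t ^ (μ - 1) * (e23 * wrightPhi (-(α/3)) μ (e23 * ((x / t ^ (α/3) : ℝ) : ℂ))).re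

/-- Second fundamental solution `V_α^μ(x,t)` of the time-fractional Airy equation. -/
noncomputable def Vfun (α μ : ℝ) (x t : ℝ) : ℝ :=
  (1/3) * t ^ (μ - 1) * (e23 * wrightPhi (-(α/3)) μ (e23 * ((x / t ^ (α/3) : ℝ) : ℂ))).im

/-- `G_α^μ` extended across `x = 0` by its common one-sided limit. -/
noncomputable def Ghat (α μ : ℝ) (x t : ℝ) : ℝ :=
  if x = 0 then t ^ (μ - 1) / (3 * Real.Gamma μ) else Gfun α μ x t

/-- The `j`-th open bond of the star graph with `k` incoming finite bonds `(L_j, 0)`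
(`L_j < 0`) and `m` outgoing finite bonds `(0, L_j)` (`L_j > 0`). -/
def fBond (k m : ℕ) (L : Fin (k + m) → ℝ) (j : Fin (k + m)) : Set ℝ :=
  if (j : ℕ) < k then Set.Ioo (L j) 0 else Set.Ioo 0 (L j)

/-- The closure of the `j`-th finite bond. -/
def fclBond (k m : ℕ) (L : Fin (k + m) → ℝ) (j : Fin (k + m)) : Set ℝ :=
  if (j : ℕ) < k then Set.Icc (L j) 0 else Set.Icc 0 (L j)

/-- A classical solution on the star graph with finite bonds: each component is
continuous on `closure(b_j) × [0,T]`, three times continuously differentiable in `x`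
for `0 < t ≤ T`, and continuously differentiable in `t` on `[0,T]`. -/
structure IsClassicalSol (k m : ℕ) (T : ℝ) (L : Fin (k + m) → ℝ)
    (u : Fin (k + m) → ℝ → ℝ → ℝ) : Prop where
  cont : ∀ j, ContinuousOn (fun p : ℝ × ℝ => u j p.1 p.2) (fclBond k m L j ×ˢ Set.Icc 0 T)
  smooth_x : ∀ j, ∀ t ∈ Set.Ioc 0 T, ContDiffOn ℝ 3 (fun x => u j x t) (fclBond k m L j)
  smooth_t : ∀ j, ∀ x ∈ fclBond k m L j, ContDiffOn ℝ 1 (fun s => u j x s) (Set.Icc 0 T)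

/-- The initial-boundary value problem for the time-fractional Airy equation on the
star graph with finite bonds: the equation on each bond, initial conditions, vertex
(gluing) conditions at `x = 0` and boundary conditions at the outer ends `x = L_j`. -/
structure SolvesIBVP (k m : ℕ) (hk : 0 < k) (α T : ℝ) (L : Fin (k + m) → ℝ)
    (a : Fin (k + m) → ℝ) (B : Matrix (Fin m) (Fin k) ℝ)
    (u0 : Fin (k + m) → ℝ → ℝ) (f : Fin (k + m) → ℝ → ℝ → ℝ)
    (φ : Fin (k + m) → ℝ → ℝ) (ψ : Fin k → ℝ → ℝ)
    (u : Fin (k + m) → ℝ → ℝ → ℝ) : Prop where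
  eqn : ∀ j, ∀ x ∈ fBond k m L j, ∀ t ∈ Set.Ioc 0 T,
    caputoD α (fun s => u j x s) t - deriv (deriv (deriv (fun y => u j y t))) x = f j x t
  init : ∀ j, ∀ x ∈ fclBond k m L j, u j x 0 = u0 j x
  vertex1 : ∀ t ∈ Set.Ioc 0 T, ∀ j : Fin (k + m),
    a j * u j 0 t = u (Fin.castAdd m ⟨0, hk⟩) 0 t
  vertex2 : ∀ t ∈ Set.Ioc 0 T, ∀ i : Fin m,
    derivWithin (fun x => u (Fin.natAdd k i) x t) (fclBond k m L (Fin.natAdd k i)) 0 =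
      ∑ j : Fin k, B i j *
        derivWithin (fun x => u (Fin.castAdd m j) x t) (fclBond k m L (Fin.castAdd m j)) 0
  vertex3 : ∀ t ∈ Set.Ioc 0 T,
    ∑ j : Fin k, (1 / a (Fin.castAdd m j)) *
        iteratedDerivWithin 2 (fun x => u (Fin.castAdd m j) x t)
          (fclBond k m L (Fin.castAdd m j)) 0 =
      ∑ i : Fin m, (1 / a (Fin.natAdd k i)) *
        iteratedDerivWithin 2 (fun x => u (Fin.natAdd k i) x t)
          (fclBond k m L (Fin.natAdd k i)) 0
  bdry1 : ∀ t ∈ Set.Ioc 0 T, ∀ j : Fin (k + m), u j (L j) t = φ j t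
  bdry2 : ∀ t ∈ Set.Ioc 0 T, ∀ j : Fin k,
    derivWithin (fun x => u (Fin.castAdd m j) x t)
      (fclBond k m L (Fin.castAdd m j)) (L (Fin.castAdd m j)) = ψ j t

theorem ker_ii {γ : ℝ} (hγ : -1 < γ) (t a b : ℝ) :
    IntervalIntegrable (fun s => (t - s) ^ γ) volume a b := by
  have h := (intervalIntegral.intervalIntegrable_rpow' (a := t - a) (b := t - b) hγ).comp_sub_left t
  simpa using h

theorem ker_ii' {γ : ℝ} (hγ : -1 < γ) (t a b : ℝ) :
    IntervalIntegrable (fun s => (s - t) ^ γ) volume a b := by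
  have h := (intervalIntegral.intervalIntegrable_rpow' (a := a - t) (b := b - t) hγ).comp_sub_right t
  simpa using h

theorem kerq_ii {γ : ℝ} (hγ : -1 < γ) (t a b : ℝ) {q : ℝ → ℝ} (hq : Continuous q) :
    IntervalIntegrable (fun s => (t - s) ^ γ * q s) volume a b :=
  (ker_ii hγ t a b).mul_continuousOn hq.continuousOn

theorem ker_int {γ : ℝ} (hγ : -1 < γ) (a t : ℝ) :
    ∫ s in a..t, (t - s) ^ γ = (t - a) ^ (γ + 1) / (γ + 1) := by
  rw [intervalIntegral.integral_comp_sub_left (fun x => x ^ γ) t, integral_rpow (Or.inl hγ)]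
  rw [sub_self, Real.zero_rpow (by linarith), sub_zero]

theorem tri {β γ : ℝ} (hβ : -1 < β) (hγ : -1 < γ) {a t : ℝ} (hat : a ≤ t) {q : ℝ → ℝ}
    (hq : Continuous q) :
    ∫ τ in a..t, (t - τ) ^ β * ∫ s in a..τ, (τ - s) ^ γ * q s
      = ∫ s in a..t, q s * ∫ τ in s..t, (t - τ) ^ β * (τ - s) ^ γ := by
  obtain ⟨M, hM⟩ := (isCompact_Icc (a := a) (b := t)).exists_bound_of_continuousOn hq.continuousOn
  set ν := volume.restrict (Ioc a t) with hν
  let K : ℝ → ℝ → ℝ := fun τ s => if s < τ then (t - τ) ^ β * ((τ - s) ^ γ * q s) else 0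
  have hKm : Measurable (Function.uncurry K) := by
    refine Measurable.ite (measurableSet_lt measurable_snd measurable_fst) ?_ measurable_const
    have := hq.measurable
    fun_prop
  -- inner integrals
  have in1 : ∀ (G : ℝ → ℝ), ∀ τ ∈ Ioc a t, ∫ s, (if s < τ then G s else 0) ∂ν
      = ∫ s in a..τ, G s := by
    intro G τ hτ
    have : (fun s => if s < τ then G s else 0) = (Iio τ).indicator G := by
      ext s; simp [indicator]
    rw [this, integral_indicator measurableSet_Iio, hν, Measure.restrict_restrict measurableSet_Iio,
      intervalIntegral.integral_of_le hτ.1.le, integral_Ioc_eq_integral_Ioo]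
    congr 2
    ext s; constructor
    · rintro ⟨h1, h2⟩; exact ⟨h2.1, h1⟩
    · rintro ⟨h1, h2⟩; exact ⟨h2, h1, h2.le.trans hτ.2⟩
  have in2 : ∀ (G : ℝ → ℝ), ∀ s ∈ Ioc a t, ∫ τ, (if s < τ then G τ else 0) ∂ν
      = ∫ τ in s..t, G τ := by
    intro G s hs
    have : (fun τ => if s < τ then G τ else 0) = (Ioi s).indicator G := by
      ext τ; simp [indicator]
    rw [this, integral_indicator measurableSet_Ioi, hν, Measure.restrict_restrict measurableSet_Ioi,
      intervalIntegral.integral_of_le hs.2]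
    congr 2
    ext τ; constructor
    · rintro ⟨h1, h2⟩; exact ⟨h1, h2.2⟩
    · rintro ⟨h1, h2⟩; exact ⟨h1, hs.1.trans h1, h2⟩
  have hint : Integrable (Function.uncurry K) (ν.prod ν) := by
    rw [integrable_prod_iff hKm.aestronglyMeasurable]
    constructor
    · refine (ae_restrict_iff' measurableSet_Ioc).2 (Eventually.of_forall fun τ hτ => ?_)
      have : (fun s => Function.uncurry K (τ, s))
          = (Iio τ).indicator (fun s => (t - τ) ^ β * ((τ - s) ^ γ * q s)) := by
        ext s; simp [K, Function.uncurry, indicator]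
      rw [this]
      refine Integrable.indicator ?_ measurableSet_Iio
      refine Integrable.const_mul ?_ _
      have := kerq_ii hγ τ a t hq
      rwa [intervalIntegrable_iff_integrableOn_Ioc_of_le hat] at this
    · have hb : Integrable (fun τ => (t - τ) ^ β * (M * ((t - a) ^ (γ + 1) / (γ + 1)))) ν := by
        refine Integrable.mul_const ?_ _
        have := ker_ii hβ t a t
        rwa [intervalIntegrable_iff_integrableOn_Ioc_of_le hat] at this
      refine hb.mono' hKm.aestronglyMeasurable.norm.integral_prod_right' ?_
      refine (ae_restrict_iff' measurableSet_Ioc).2 (Eventually.of_forall fun τ hτ => ?_)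
      have h1 : (fun s => ‖Function.uncurry K (τ, s)‖)
          = fun s => if s < τ then (t - τ) ^ β * (|τ - s| ^ 0 * ‖(τ - s) ^ γ * q s‖) else 0 := by
        ext s
        simp only [K, Function.uncurry]
        split_ifs with h
        · rw [norm_mul, Real.norm_of_nonneg (Real.rpow_nonneg (by linarith [hτ.2]) _)]; simp
        · simp
      simp only [h1]
      rw [in1 _ τ hτ, Real.norm_of_nonneg]
      · rw [intervalIntegral.integral_const_mul]
        refine mul_le_mul_of_nonneg_left ?_ (Real.rpow_nonneg (by linarith [hτ.2]) _)
        calc _ ≤ ∫ s in a..τ, (τ - s) ^ γ * M := by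
              refine intervalIntegral.integral_mono_on hτ.1.le ?_ ((ker_ii hγ τ a τ).mul_const M) ?_
              · simpa using (kerq_ii hγ τ a τ hq).norm
              · intro s hs
                have hp := Real.rpow_nonneg (by linarith [hs.2] : 0 ≤ τ - s) γ
                rw [norm_mul, Real.norm_of_nonneg hp]
                simp only [pow_zero, one_mul]
                exact mul_le_mul_of_nonneg_left (hM s ⟨hs.1, hs.2.trans hτ.2⟩) hp
          _ = M * ((τ - a) ^ (γ + 1) / (γ + 1)) := by
              rw [intervalIntegral.integral_mul_const, ker_int hγ]; ring
          _ ≤ _ := by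
              have hM0 : 0 ≤ M := (norm_nonneg _).trans (hM a ⟨le_rfl, hat⟩)
              refine mul_le_mul_of_nonneg_left ?_ hM0
              refine div_le_div_of_nonneg_right ?_ (by linarith)
              exact Real.rpow_le_rpow (by linarith [hτ.1]) (by linarith [hτ.2]) (by linarith)
      · refine intervalIntegral.integral_nonneg hτ.1.le fun s hs => ?_
        exact mul_nonneg (Real.rpow_nonneg (by linarith [hτ.2]) _) (by positivity)
  have hsw := integral_integral_swap hint
  rw [intervalIntegral.integral_of_le hat, intervalIntegral.integral_of_le hat]
  calc _ = ∫ τ, ∫ s, K τ s ∂ν ∂ν := by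
        refine setIntegral_congr_fun measurableSet_Ioc fun τ hτ => ?_
        simp only [K]
        rw [in1 _ τ hτ, intervalIntegral.integral_const_mul]
    _ = _ := hsw
    _ = _ := by
        refine setIntegral_congr_fun measurableSet_Ioc fun s hs => ?_
        simp only [K]
        rw [in2 _ s hs, ← intervalIntegral.integral_const_mul]
        congr 1; ext τ; ring

theorem abel_const {α : ℝ} {s t : ℝ} (h : s < t) :
    ∫ τ in s..t, (t - τ) ^ (α - 1) * (τ - s) ^ (-α)
      = ∫ θ in (0:ℝ)..1, (1 - θ) ^ (α - 1) * θ ^ (-α) := by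
  have hp : 0 < t - s := by linarith
  have := intervalIntegral.smul_integral_comp_mul_add (a := 0) (b := 1)
    (fun τ => (t - τ) ^ (α - 1) * (τ - s) ^ (-α)) (t - s) s
  rw [mul_zero, zero_add, mul_one, sub_add_cancel] at this
  rw [← this, ← intervalIntegral.integral_smul]
  refine intervalIntegral.integral_congr fun θ hθ => ?_
  rw [uIcc_of_le zero_le_one] at hθ
  have e1 : t - ((t - s) * θ + s) = (t - s) * (1 - θ) := by ring
  have e2 : (t - s) * θ + s - s = (t - s) * θ := by ring
  simp only [e1, e2, smul_eq_mul]
  rw [Real.mul_rpow hp.le (by linarith [hθ.2]), Real.mul_rpow hp.le hθ.1]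
  have : (t - s) * ((t - s) ^ (α - 1) * (t - s) ^ (-α)) = 1 := by
    rw [← Real.rpow_add hp]
    nth_rewrite 1 [← Real.rpow_one (t - s)]
    rw [← Real.rpow_add hp]; ring_nf; simp
  linear_combination ((1 - θ) ^ (α - 1) * θ ^ (-α)) * this

theorem abel {α : ℝ} (h0 : 0 < α) (h1 : α < 1) {a t : ℝ} (hat : a ≤ t) {q : ℝ → ℝ}
    (hq : Continuous q) :
    ∫ τ in a..t, (t - τ) ^ (α - 1) * ∫ s in a..τ, (τ - s) ^ (-α) * q s
      = (∫ θ in (0:ℝ)..1, (1 - θ) ^ (α - 1) * θ ^ (-α)) * ∫ s in a..t, q s := by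
  rw [tri (by linarith) (by linarith) hat hq, ← intervalIntegral.integral_const_mul,
    intervalIntegral.integral_of_le hat, intervalIntegral.integral_of_le hat,
    integral_Ioc_eq_integral_Ioo, integral_Ioc_eq_integral_Ioo]
  refine setIntegral_congr_fun measurableSet_Ioo fun s hs => ?_
  rw [abel_const hs.2]; ring

theorem fk_eq (γ a t : ℝ) (q : ℝ → ℝ) :
    ∫ s in a..t, (t - s) ^ γ * q s = ∫ σ in (0:ℝ)..(t - a), σ ^ γ * q (t - σ) := by
  have := intervalIntegral.integral_comp_sub_left (a := a) (b := t) (fun σ => σ ^ γ * q (t - σ)) t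
  simp only [sub_sub_cancel, sub_self] at this
  exact this

theorem fk_eq2 {γ : ℝ} (hγ : -1 < γ) {a t : ℝ} (hat : a ≤ t) (q : ℝ → ℝ) :
    ∫ s in a..t, (t - s) ^ γ * q s
      = (t - a) ^ (γ + 1) * ∫ θ in (0:ℝ)..1, θ ^ γ * q (t - (t - a) * θ) := by
  rw [fk_eq]
  rcases hat.eq_or_lt with rfl | h
  · simp [Real.zero_rpow (by linarith : γ + 1 ≠ 0)]
  have hp : 0 < t - a := by linarith
  have := intervalIntegral.smul_integral_comp_mul_add (a := 0) (b := 1)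
    (fun σ => σ ^ γ * q (t - σ)) (t - a) 0
  simp only [mul_zero, zero_add, mul_one, add_zero] at this
  rw [← this, Real.rpow_add hp, Real.rpow_one, smul_eq_mul, mul_comm ((t - a) ^ γ), mul_assoc]
  congr 1
  rw [← intervalIntegral.integral_const_mul]
  refine intervalIntegral.integral_congr fun θ hθ => ?_
  rw [uIcc_of_le zero_le_one] at hθ
  rw [Real.mul_rpow hp.le hθ.1]; ring

theorem fk_cont {γ : ℝ} (hγ : -1 < γ) (a : ℝ) {q : ℝ → ℝ} (hq : Continuous q) :
    ContinuousOn (fun t => ∫ s in a..t, (t - s) ^ γ * q s) (Ici a) := by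
  have h1 : ContinuousOn (fun t => (t - a) ^ (γ + 1)
      * ∫ θ in (0:ℝ)..1, θ ^ γ * q (t - (t - a) * θ)) (Ici a) := by
    refine Continuous.continuousOn (Continuous.mul ?_ ?_)
    · exact Continuous.rpow_const (by fun_prop) fun x => Or.inr (by linarith)
    rw [continuous_iff_continuousAt]
    intro t0
    have hc : Continuous (fun p : ℝ × ℝ => q (p.1 - (p.1 - a) * p.2)) := by fun_prop
    obtain ⟨M, hM⟩ := ((isCompact_Icc (a := t0 - 1) (b := t0 + 1)).prod
      (isCompact_Icc (a := (0:ℝ)) (b := 1))).exists_bound_of_continuousOn hc.continuousOn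
    refine intervalIntegral.continuousAt_of_dominated_interval (bound := fun θ => |θ ^ γ| * M) ?_ ?_ ?_ ?_
    · refine Eventually.of_forall fun t => Measurable.aestronglyMeasurable ?_
      have := hq.measurable
      fun_prop
    · have : Icc (t0 - 1) (t0 + 1) ∈ 𝓝 t0 := Icc_mem_nhds (by linarith) (by linarith)
      filter_upwards [this] with t ht
      refine Eventually.of_forall fun θ hθ => ?_
      rw [uIoc_of_le zero_le_one] at hθ
      rw [norm_mul]
      exact mul_le_mul_of_nonneg_left (hM (t, θ) ⟨ht, ⟨hθ.1.le, hθ.2⟩⟩) (abs_nonneg _)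
    · exact ((intervalIntegral.intervalIntegrable_rpow' hγ).norm).mul_const M
    · refine Eventually.of_forall fun θ _ => ?_
      fun_prop
  exact h1.congr fun t ht => fk_eq2 hγ ht q

theorem scalar_max {α : ℝ} (h0 : 0 < α) (h1 : α < 1) {q : ℝ → ℝ} (hq : Continuous q)
    {e a b κ : ℝ} (hea : e ≤ a) (hab : a < b) (hq0 : ∀ s ∈ Icc e b, 0 ≤ q s) (hqb : q b = 0)
    (hκ : 0 < κ)
    (hinc : ∀ t1 t2, a ≤ t1 → t1 ≤ t2 → t2 ≤ b → κ * (t2 - t1) ≤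
      (∫ s in e..t2, (t2 - s) ^ (-α) * q s) - ∫ s in e..t1, (t1 - s) ^ (-α) * q s) : False := by
  have hγ : -1 < -α := by linarith
  set Q : ℝ → ℝ := fun t => ∫ s in a..t, (t - s) ^ (-α) * q s with hQ
  have hsplit : ∀ t, (∫ s in e..t, (t - s) ^ (-α) * q s)
      = (∫ s in e..a, (t - s) ^ (-α) * q s) + Q t := fun t =>
    (intervalIntegral.integral_add_adjacent_intervals (kerq_ii hγ t e a hq)
      (kerq_ii hγ t a t hq)).symm
  have hQinc : ∀ t1 t2, a < t1 → t1 ≤ t2 → t2 ≤ b → κ * (t2 - t1) ≤ Q t2 - Q t1 := by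
    intro t1 t2 ha1 h12 h2b
    have h := hinc t1 t2 ha1.le h12 h2b
    rw [hsplit t2, hsplit t1] at h
    have hfar : (∫ s in e..a, (t2 - s) ^ (-α) * q s) ≤ ∫ s in e..a, (t1 - s) ^ (-α) * q s := by
      refine intervalIntegral.integral_mono_on hea (kerq_ii hγ t2 e a hq) (kerq_ii hγ t1 e a hq) ?_
      intro s hs
      refine mul_le_mul_of_nonneg_right ?_ (hq0 s ⟨hs.1, by linarith [hs.2]⟩)
      exact Real.rpow_le_rpow_of_nonpos (by linarith [hs.2]) (by linarith) (by linarith)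
    linarith
  have hQ0 : ∀ t, a ≤ t → t ≤ b → 0 ≤ Q t := by
    intro t hat htb
    refine intervalIntegral.integral_nonneg hat fun s hs => ?_
    exact mul_nonneg (Real.rpow_nonneg (by linarith [hs.2]) _) (hq0 s ⟨hea.trans hs.1, hs.2.trans htb⟩)
  have hQc : ContinuousOn Q (Ici a) := fk_cont hγ a hq
  set c := ∫ θ in (0:ℝ)..1, (1 - θ) ^ (α - 1) * θ ^ (-α) with hc
  set δ := b - a with hδ
  have hδ0 : 0 < δ := by linarith
  set C := (δ / 2) ^ α / α with hC
  have hC0 : 0 < C := div_pos (Real.rpow_pos_of_pos (by linarith) _) h0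
  have key : ∀ h, 0 < h → h ≤ δ / 2 → κ * h * C ≤ c * ∫ s in (b - h)..b, q s := by
    intro h hh hhd
    have eR1 := abel h0 h1 hab.le hq
    have eR2 := abel h0 h1 (show a ≤ b - h by linarith) hq
    have hii : (∫ s in (b - h)..b, q s) = (∫ s in a..b, q s) - ∫ s in a..(b - h), q s := by
      rw [eq_sub_iff_add_eq, add_comm]
      exact intervalIntegral.integral_add_adjacent_intervals (hq.intervalIntegrable _ _)
        (hq.intervalIntegrable _ _)
    rw [hii, mul_sub, ← hc] at *
    rw [← eR1, ← eR2]
    have f1 := fk_eq (α - 1) a b Q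
    have f2 := fk_eq (α - 1) a (b - h) Q
    simp only [hQ] at f1 f2
    rw [f1, f2]
    have hk : -1 < α - 1 := by linarith
    have ii : ∀ (t u v : ℝ), t - max u v ≥ a → IntervalIntegrable (fun σ => σ ^ (α - 1) * Q (t - σ)) volume u v := by
      intro t u v hu
      refine (intervalIntegral.intervalIntegrable_rpow' hk).mul_continuousOn ?_
      refine hQc.comp (by fun_prop) ?_
      intro σ hσ
      have : σ ≤ max u v := hσ.2
      simp only [mem_Ici]; linarith
    have s1 : (∫ σ in (0:ℝ)..(b - a), σ ^ (α - 1) * Q (b - σ)) =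
        (∫ σ in (0:ℝ)..(b - h - a), σ ^ (α - 1) * Q (b - σ))
        + ∫ σ in (b - h - a)..(b - a), σ ^ (α - 1) * Q (b - σ) := by
      refine (intervalIntegral.integral_add_adjacent_intervals (ii _ _ _ ?_) (ii _ _ _ ?_)).symm
      · rw [max_eq_right (by linarith)]; linarith
      · rw [max_eq_right (by linarith)]; linarith
    have s2 : 0 ≤ ∫ σ in (b - h - a)..(b - a), σ ^ (α - 1) * Q (b - σ) := by
      refine intervalIntegral.integral_nonneg (by linarith) fun σ hσ => ?_
      exact mul_nonneg (Real.rpow_nonneg (by linarith [hσ.1]) _)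
        (hQ0 _ (by linarith [hσ.2]) (by linarith [hσ.1]))
    have s3 : (∫ σ in (0:ℝ)..(b - h - a), σ ^ (α - 1) * (κ * h)) ≤
        (∫ σ in (0:ℝ)..(b - h - a), (σ ^ (α - 1) * Q (b - σ) - σ ^ (α - 1) * Q (b - h - σ))) := by
      refine intervalIntegral.integral_mono_on_of_le_Ioo (by linarith)
        ((intervalIntegral.intervalIntegrable_rpow' hk).mul_const _) ((ii _ _ _ ?_).sub (ii _ _ _ ?_)) ?_
      · rw [max_eq_right (by linarith)]; linarith
      · rw [max_eq_right (by linarith)]; linarith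
      intro σ hσ
      rw [← mul_sub]
      refine mul_le_mul_of_nonneg_left ?_ (Real.rpow_nonneg hσ.1.le _)
      have := hQinc (b - h - σ) (b - σ) (by linarith [hσ.2]) (by linarith) (by linarith [hσ.1])
      have e : b - σ - (b - h - σ) = h := by ring
      rw [e] at this; exact this
    rw [intervalIntegral.integral_sub (ii _ _ _ (by rw [max_eq_right (by linarith)]; linarith))
      (ii _ _ _ (by rw [max_eq_right (by linarith)]; linarith)), intervalIntegral.integral_mul_const,
      integral_rpow (Or.inl hk)] at s3
    have s4 : C ≤ ((b - h - a) ^ (α - 1 + 1) - 0 ^ (α - 1 + 1)) / (α - 1 + 1) := by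
      rw [sub_add_cancel, Real.zero_rpow h0.ne', sub_zero, hC]
      refine div_le_div_of_nonneg_right ?_ h0.le
      exact Real.rpow_le_rpow (by linarith) (by linarith) h0.le
    have s5 : κ * h * C ≤ ((b - h - a) ^ (α - 1 + 1) - 0 ^ (α - 1 + 1)) / (α - 1 + 1) * (κ * h) := by
      rw [mul_comm]; exact mul_le_mul_of_nonneg_right s4 (by positivity)
    simp only [hQ] at s1 s2 s3 ⊢
    linarith
  have hε : 0 < κ * C / (2 * (|c| + 1)) := by positivity
  obtain ⟨d, hd, hdq⟩ := Metric.continuous_iff.1 hq b _ hε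
  set h := min (δ / 2) (d / 2) with hh
  have hh0 : 0 < h := lt_min (by linarith) (by linarith)
  have k1 := key h hh0 (min_le_left _ _)
  have k2 : ‖∫ s in (b - h)..b, q s‖ ≤ κ * C / (2 * (|c| + 1)) * |b - (b - h)| := by
    refine intervalIntegral.norm_integral_le_of_norm_le_const fun s hs => ?_
    rw [uIoc_of_le (by linarith)] at hs
    have := hdq s (by
      rw [Real.dist_eq, abs_lt]
      have : h ≤ d / 2 := min_le_right _ _
      constructor <;> linarith [hs.1, hs.2])
    rw [hqb, dist_zero_right] at this
    exact this.le
  rw [sub_sub_cancel, abs_of_pos hh0] at k2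
  have k3 : c * ∫ s in (b - h)..b, q s ≤ |c| * (κ * C / (2 * (|c| + 1)) * h) := by
    refine (le_abs_self _).trans ?_
    rw [abs_mul]
    exact mul_le_mul_of_nonneg_left k2 (abs_nonneg _)
  have k4 : |c| * (κ * C / (2 * (|c| + 1)) * h) ≤ κ * h * C / 2 := by
    have hc1 : 0 < |c| + 1 := by positivity
    have : |c| * (κ * C / (2 * (|c| + 1)) * h) = (κ * h * C / 2) * (|c| / (|c| + 1)) := by
      field_simp
    rw [this]
    have h2 : |c| / (|c| + 1) ≤ 1 := by rw [div_le_one hc1]; linarith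
    exact mul_le_of_le_one_right (by positivity) h2
  have : 0 < κ * h * C := by positivity
  linarith

/-- maximum principle in increment form -/
theorem frac_max {α : ℝ} (h0 : 0 < α) (h1 : α < 1) {g : ℝ → ℝ} (hg : Continuous g)
    {e a b R : ℝ} (hea : e ≤ a) (hab : a < b) (hmax : ∀ s ∈ Icc e b, g s ≤ g b) (hgb : 0 ≤ g b)
    (hinc : ∀ t1 t2, a ≤ t1 → t1 ≤ t2 → t2 ≤ b →
      (∫ s in e..t2, (t2 - s) ^ (-α) * g s) - (∫ s in e..t1, (t1 - s) ^ (-α) * g s)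
        ≤ R * (t2 - t1)) : g b * (b - e) ^ (-α) ≤ R := by
  by_contra hcon
  push Not at hcon
  have hγ : -1 < -α := by linarith
  refine scalar_max (q := fun s => g b - g s) (κ := g b * (b - e) ^ (-α) - R) h0 h1
    (by fun_prop) hea hab (fun s hs => by linarith [hmax s hs]) (by simp) (by linarith) ?_
  intro t1 t2 ha1 h12 h2b
  have hh := hinc t1 t2 ha1 h12 h2b
  have e1 : ∀ t, (∫ s in e..t, (t - s) ^ (-α) * (g b - g s))
      = g b * ((t - e) ^ (1 - α) / (1 - α)) - ∫ s in e..t, (t - s) ^ (-α) * g s := by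
    intro t
    simp only [mul_sub]
    rw [intervalIntegral.integral_sub ((ker_ii hγ t e t).mul_const _) (kerq_ii hγ t e t hg),
      intervalIntegral.integral_mul_const, ker_int hγ]
    rw [show -α + 1 = 1 - α by ring]; ring
  rw [e1, e1]
  have e2 : (t2 - t1) * (b - e) ^ (-α) ≤ (t2 - e) ^ (1 - α) / (1 - α) - (t1 - e) ^ (1 - α) / (1 - α) := by
    have i1 := integral_rpow (a := t1 - e) (b := t2 - e) (Or.inl hγ)
    have i2 : ∫ s in (t1 - e)..(t2 - e), (b - e) ^ (-α) ≤ ∫ s in (t1 - e)..(t2 - e), s ^ (-α) := by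
      refine intervalIntegral.integral_mono_on_of_le_Ioo (by linarith) (by simp)
        (intervalIntegral.intervalIntegrable_rpow' hγ) fun s hs => ?_
      exact Real.rpow_le_rpow_of_nonpos (by linarith [hs.1]) (by linarith [hs.2]) (by linarith)
    rw [i1, intervalIntegral.integral_const, smul_eq_mul, show -α + 1 = 1 - α by ring, sub_div] at i2
    linarith [i2, show t2 - e - (t1 - e) = t2 - t1 by ring, show (t2 - e - (t1 - e)) * (b - e) ^ (-α) = (t2 - t1) * (b - e) ^ (-α) by ring]
  have e3 := mul_le_mul_of_nonneg_left e2 hgb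
  nlinarith [e3, hh]

theorem cayley {H : Type*} [NormedAddCommGroup H] [InnerProductSpace ℝ H] [CompleteSpace H]
    (A : Submodule ℝ (H × H)) (hA : ∀ p ∈ A, inner ℝ p.1 p.2 ≤ 0) {l : ℝ} (hl : 0 < l) :
    ∃ S : H →L[ℝ] H, (∀ Y, ‖S Y‖ ^ 2 ≤ inner ℝ (S Y) Y) ∧
      ∀ p ∈ A, S (l • p.1 - p.2) = l • p.1 := by
  let D : A →ₗ[ℝ] H := (l • LinearMap.fst ℝ H H - LinearMap.snd ℝ H H) ∘ₗ A.subtype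
  let R : A →ₗ[ℝ] H := (l • LinearMap.fst ℝ H H + LinearMap.snd ℝ H H) ∘ₗ A.subtype
  have hD : ∀ p : A, D p = l • p.1.1 - p.1.2 := fun p => rfl
  have hR : ∀ p : A, R p = l • p.1.1 + p.1.2 := fun p => rfl
  let V := (LinearMap.range D).topologicalClosure
  haveI : CompleteSpace V := (Submodule.isClosed_topologicalClosure _).completeSpace_coe
  have hmem : ∀ p : A, D p ∈ V := fun p =>
    Submodule.le_topologicalClosure _ (LinearMap.mem_range_self D p)
  let e : A →ₗ[ℝ] V := D.codRestrict V hmem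
  have hdense : DenseRange e := by
    intro y
    have hy : (y : H) ∈ closure (LinearMap.range D : Set H) := y.2
    rw [mem_closure_iff_seq_limit] at hy ⊢
    obtain ⟨x, hx, hxy⟩ := hy
    choose p hp using hx
    refine ⟨fun n => e (p n), fun n => ⟨p n, rfl⟩, ?_⟩
    rw [tendsto_subtype_rng]
    refine hxy.congr fun n => (hp n).symm
  have hnorm : ∀ p : A, ‖R p‖ ≤ 1 * ‖e p‖ := by
    intro p
    rw [one_mul]
    change ‖R p‖ ≤ ‖D p‖
    refine le_of_sq_le_sq ?_ (norm_nonneg _) 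
    rw [hD, hR, norm_add_sq_real, norm_sub_sq_real, inner_smul_left]
    have := hA p.1 p.2
    simp only [conj_trivial]
    nlinarith
  let T0 : V →L[ℝ] H := R.extendOfNorm e
  have hT0 : ∀ p, T0 (e p) = R p := fun p => LinearMap.extendOfNorm_eq hdense ⟨1, hnorm⟩ p
  have hT0n : ∀ x, ‖T0 x‖ ≤ 1 * ‖x‖ := LinearMap.norm_extendOfNorm_apply_le hdense 1 hnorm
  let T : H →L[ℝ] H := T0 ∘L V.orthogonalProjectionOnto
  have hTn : ∀ Y, ‖T Y‖ ≤ ‖Y‖ := by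
    intro Y
    refine (hT0n _).trans ?_
    rw [one_mul]
    exact Submodule.norm_orthogonalProjectionOnto_apply_le V Y
  have hTD : ∀ p, T (D p) = R p := by
    intro p
    rw [← hT0 p]
    change T0 _ = _
    congr 1
    exact Submodule.orthogonalProjectionOnto_mem_subspace_eq_self (e p)
  refine ⟨(2⁻¹ : ℝ) • (ContinuousLinearMap.id ℝ H + T), ?_, ?_⟩
  · intro Y
    simp only [ContinuousLinearMap.smul_apply, ContinuousLinearMap.add_apply,
      ContinuousLinearMap.id_apply]
    rw [norm_smul, mul_pow, norm_add_sq_real, inner_smul_left, inner_add_left, real_inner_self_eq_norm_sq,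
      real_inner_comm]
    have := hTn Y
    have h3 := norm_nonneg (T Y)
    simp only [conj_trivial]
    norm_num
    nlinarith
  · intro p hp
    have := hTD ⟨p, hp⟩
    rw [hD, hR] at this
    simp only at this
    simp only [ContinuousLinearMap.smul_apply, ContinuousLinearMap.add_apply,
      ContinuousLinearMap.id_apply, this]
    rw [show l • p.1 - p.2 + (l • p.1 + p.2) = (2:ℝ) • (l • p.1) by rw [two_smul]; abel, smul_smul]
    norm_num

theorem klip {β δ : ℝ} (hβ : β ≤ 0) (hδ : 0 < δ) (x y : ℝ) :
    |(max x δ) ^ β - (max y δ) ^ β| ≤ (-β) * δ ^ (β - 1) * |x - y| := by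
  have h1 : ∀ z ∈ Ici δ, HasDerivWithinAt (fun z : ℝ => z ^ β) (β * z ^ (β - 1)) (Ici δ) z :=
    fun z hz => (Real.hasDerivAt_rpow_const (Or.inl (lt_of_lt_of_le hδ hz).ne')).hasDerivWithinAt
  have h2 : ∀ z ∈ Ici δ, ‖β * z ^ (β - 1)‖ ≤ (-β) * δ ^ (β - 1) := by
    intro z hz
    have hz0 : 0 < z := lt_of_lt_of_le hδ hz
    rw [norm_mul, Real.norm_of_nonneg (Real.rpow_nonneg hz0.le _), Real.norm_eq_abs, abs_of_nonpos hβ]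
    exact mul_le_mul_of_nonneg_left (Real.rpow_le_rpow_of_nonpos hδ hz (by linarith)) (by linarith)
  have h3 := (convex_Ici δ).norm_image_sub_le_of_norm_hasDerivWithin_le h1 h2
    (le_max_right y δ : max y δ ∈ Ici δ) (le_max_right x δ : max x δ ∈ Ici δ)
  refine h3.trans (mul_le_mul_of_nonneg_left ?_ ?_)
  · exact abs_max_sub_max_le_abs x y δ
  · exact mul_nonneg (by linarith) (Real.rpow_nonneg hδ.le _)

theorem kcont {β δ : ℝ} (hδ : 0 < δ) : Continuous fun x : ℝ => (max x δ) ^ β :=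
  (continuous_id.max continuous_const).rpow_const fun x => Or.inl (lt_of_lt_of_le hδ (le_max_right _ _)).ne'

theorem kappa_inc {α δ c t1 t2 : ℝ} (hδ : 0 < δ) (hc : 0 ≤ c) (h1 : c + δ ≤ t1)
    (h12 : t1 ≤ t2) {q : ℝ → ℝ} (hq : Continuous q) :
    (∫ s in (0:ℝ)..c, (t2 - s) ^ (-α) * q s) - (∫ s in (0:ℝ)..c, (t1 - s) ^ (-α) * q s)
      = ∫ τ in t1..t2, -α * ∫ s in (0:ℝ)..c, (max (τ - s) δ) ^ (-α - 1) * q s := by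
  have hcc : Continuous (Function.uncurry fun τ s : ℝ => (max (τ - s) δ) ^ (-α - 1) * q s) := by
    refine Continuous.mul ((kcont hδ).comp (by fun_prop)) (by fun_prop)
  have hint : IntegrableOn (Function.uncurry fun τ s : ℝ => (max (τ - s) δ) ^ (-α - 1) * q s)
      (uIoc t1 t2 ×ˢ uIoc 0 c) := by
    exact (hcc.continuousOn.integrableOn_compact (isCompact_uIcc.prod isCompact_uIcc)).mono_set
      (prod_mono uIoc_subset_uIcc uIoc_subset_uIcc)
  rw [intervalIntegral.integral_const_mul,
    intervalIntegral_intervalIntegral_swap hint]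
  have ii : ∀ t, c + δ ≤ t → IntervalIntegrable (fun s => (t - s) ^ (-α) * q s) volume 0 c := by
    intro t ht
    refine ContinuousOn.intervalIntegrable (ContinuousOn.mul ?_ hq.continuousOn)
    refine ContinuousOn.rpow_const (by fun_prop) fun s hs => Or.inl ?_
    rw [uIcc_of_le hc] at hs
    linarith [hs.2]
  rw [← intervalIntegral.integral_sub (ii _ (by linarith)) (ii _ h1), ← intervalIntegral.integral_const_mul]
  refine intervalIntegral.integral_congr fun s hs => ?_
  rw [uIcc_of_le hc] at hs
  have e1 : (∫ τ in t1..t2, (max (τ - s) δ) ^ (-α - 1) * q s)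
      = (∫ τ in (t1 - s)..(t2 - s), τ ^ (-α - 1)) * q s := by
    rw [intervalIntegral.integral_mul_const, ← intervalIntegral.integral_comp_sub_right (fun x => x ^ (-α - 1)) s]
    congr 1
    refine intervalIntegral.integral_congr fun τ hτ => ?_
    rw [uIcc_of_le h12] at hτ
    rw [max_eq_left (by linarith [hτ.1, hs.2])]
  have e2 : -α * ∫ τ in (t1 - s)..(t2 - s), τ ^ (-α - 1) = (t2 - s) ^ (-α) - (t1 - s) ^ (-α) := by
    rw [← intervalIntegral.integral_const_mul]
    refine intervalIntegral.integral_eq_sub_of_hasDerivAt (f := fun z => z ^ (-α)) ?_ ?_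
    · intro z hz
      rw [uIcc_of_le (by linarith)] at hz
      exact Real.hasDerivAt_rpow_const (Or.inl (by linarith [hz.1, hs.2]))
    · refine ContinuousOn.intervalIntegrable (ContinuousOn.mul continuousOn_const ?_)
      refine ContinuousOn.rpow_const continuousOn_id fun z hz => Or.inl ?_
      rw [uIcc_of_le (by linarith)] at hz
      linarith [hz.1, hs.2]
  simp only [e1]
  rw [← mul_assoc, e2]; ring

theorem scalar_est {α : ℝ} (h0 : 0 < α) (h1 : α < 1) {q ζ : ℝ → ℝ} (hq : Continuous q)
    (hζ : Continuous ζ) {c e e1 a b d Q Z0 Z1 ε : ℝ} (hc : 0 ≤ c) (hce : c ≤ e) (hee : e < e1)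
    (ha : e1 ≤ a) (hab : a < b) (hbd : b ≤ d) (hQ : ∀ s ∈ Icc c e, |q s| ≤ Q)
    (hZ0 : ∀ s, |ζ s| ≤ Z0) (hZ1 : ∀ s s', |ζ s - ζ s'| ≤ Z1 * |s - s'|)
    (hmax : ∀ s ∈ Icc e b, q s - ζ s ≤ q b - ζ b) (hgb : 0 ≤ q b - ζ b)
    (hinc : ∀ t1 t2, a ≤ t1 → t1 ≤ t2 → t2 ≤ b →
      ((∫ s in (0:ℝ)..t2, (t2 - s) ^ (-α) * q s) - (∫ s in (0:ℝ)..t1, (t1 - s) ^ (-α) * q s))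
      - ((∫ s in (0:ℝ)..c, (t2 - s) ^ (-α) * q s) - (∫ s in (0:ℝ)..c, (t1 - s) ^ (-α) * q s))
        ≤ ε * (t2 - t1)) :
    (q b - ζ b) * (b - e) ^ (-α) ≤ ε + α * (e1 - e) ^ (-α - 1) * Q * (e - c)
      + (Z1 * ((d - e) ^ (1 - α) / (1 - α)) + (e1 - e) ^ (-α) * Z0) := by
  have hγ : -1 < -α := by linarith
  have hQ0 : 0 ≤ Q := (abs_nonneg _).trans (hQ c ⟨le_rfl, hce⟩)
  have hZ00 : 0 ≤ Z0 := (abs_nonneg _).trans (hZ0 0)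
  have hZ10 : 0 ≤ Z1 := by
    have := (abs_nonneg _).trans (hZ1 0 1)
    simpa using this
  refine frac_max (g := fun s => q s - ζ s) (a := a) h0 h1 (by fun_prop) (by linarith) hab hmax hgb ?_
  intro t1 t2 ha1 h12 h2b
  have hh := hinc t1 t2 ha1 h12 h2b
  have sp : ∀ t, (∫ s in e..t, (t - s) ^ (-α) * (q s - ζ s))
      = (∫ s in (0:ℝ)..t, (t - s) ^ (-α) * q s) - (∫ s in (0:ℝ)..c, (t - s) ^ (-α) * q s)
        - (∫ s in c..e, (t - s) ^ (-α) * q s) - ∫ s in e..t, (t - s) ^ (-α) * ζ s := by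
    intro t
    simp only [mul_sub]
    rw [intervalIntegral.integral_sub (kerq_ii hγ t e t hq) (kerq_ii hγ t e t hζ)]
    have := intervalIntegral.integral_add_adjacent_intervals (kerq_ii hγ t 0 c hq) (kerq_ii hγ t c e hq)
    have := intervalIntegral.integral_add_adjacent_intervals (kerq_ii hγ t 0 e hq) (kerq_ii hγ t e t hq)
    linarith
  rw [sp, sp]
  have hP : |(∫ s in c..e, (t2 - s) ^ (-α) * q s) - ∫ s in c..e, (t1 - s) ^ (-α) * q s|
      ≤ (α * (e1 - e) ^ (-α - 1) * Q * (t2 - t1)) * |e - c| := by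
    rw [← intervalIntegral.integral_sub (kerq_ii hγ t2 c e hq) (kerq_ii hγ t1 c e hq)]
    rw [← Real.norm_eq_abs]
    refine intervalIntegral.norm_integral_le_of_norm_le_const fun s hs => ?_
    rw [uIoc_of_le hce] at hs
    have kl := klip (β := -α) (by linarith) (show 0 < e1 - e by linarith) (t2 - s) (t1 - s)
    rw [max_eq_left (by linarith [hs.2]), max_eq_left (by linarith [hs.2])] at kl
    rw [← sub_mul, norm_mul, Real.norm_eq_abs, Real.norm_eq_abs]
    have e3 : |t2 - s - (t1 - s)| = t2 - t1 := by rw [abs_of_nonneg] <;> linarith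
    rw [e3, neg_neg] at kl
    calc _ ≤ (α * (e1 - e) ^ (-α - 1) * (t2 - t1)) * Q :=
          mul_le_mul kl (hQ s ⟨hs.1.le, hs.2⟩) (abs_nonneg _) ((abs_nonneg _).trans kl)
      _ = _ := by ring
  rw [abs_of_nonneg (a := e - c) (by linarith)] at hP
  have zc : ∀ t, Continuous fun σ => ζ (t - σ) := fun t => by fun_prop
  have zi : ∀ t u v, IntervalIntegrable (fun σ => σ ^ (-α) * ζ (t - σ)) volume u v := fun t u v =>
    (intervalIntegral.intervalIntegrable_rpow' hγ).mul_continuousOn (zc t).continuousOn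
  have hN : |(∫ s in e..t2, (t2 - s) ^ (-α) * ζ s) - ∫ s in e..t1, (t1 - s) ^ (-α) * ζ s|
      ≤ (Z1 * ((d - e) ^ (1 - α) / (1 - α)) + (e1 - e) ^ (-α) * Z0) * (t2 - t1) := by
    rw [fk_eq, fk_eq]
    rw [← intervalIntegral.integral_add_adjacent_intervals (zi t2 0 (t1 - e)) (zi t2 (t1 - e) (t2 - e)),
      add_sub_right_comm, ← intervalIntegral.integral_sub (zi t2 _ _) (zi t1 _ _)]
    have n1 : |∫ σ in (0:ℝ)..(t1 - e), (σ ^ (-α) * ζ (t2 - σ) - σ ^ (-α) * ζ (t1 - σ))|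
        ≤ ∫ σ in (0:ℝ)..(t1 - e), σ ^ (-α) * (Z1 * (t2 - t1)) := by
      rw [← Real.norm_eq_abs]
      refine intervalIntegral.norm_integral_le_of_norm_le (by linarith) ?_
        ((intervalIntegral.intervalIntegrable_rpow' hγ).mul_const _)
      refine Eventually.of_forall fun σ hσ => ?_
      rw [← mul_sub, norm_mul, Real.norm_of_nonneg (Real.rpow_nonneg hσ.1.le _)]
      refine mul_le_mul_of_nonneg_left ?_ (Real.rpow_nonneg hσ.1.le _)
      have := hZ1 (t2 - σ) (t1 - σ)
      rwa [show t2 - σ - (t1 - σ) = t2 - t1 by ring, abs_of_nonneg (a := t2 - t1) (by linarith)] at this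
    rw [intervalIntegral.integral_mul_const, integral_rpow (Or.inl hγ), Real.zero_rpow (by linarith),
      show -α + 1 = 1 - α by ring, sub_zero] at n1
    have n2 : |∫ σ in (t1 - e)..(t2 - e), σ ^ (-α) * ζ (t2 - σ)|
        ≤ (e1 - e) ^ (-α) * Z0 * |t2 - e - (t1 - e)| := by
      rw [← Real.norm_eq_abs]
      refine intervalIntegral.norm_integral_le_of_norm_le_const fun σ hσ => ?_
      rw [uIoc_of_le (by linarith)] at hσ
      have hσ0 : e1 - e ≤ σ := by linarith [hσ.1]
      rw [norm_mul, Real.norm_of_nonneg (Real.rpow_nonneg (by linarith) _)]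
      exact mul_le_mul (Real.rpow_le_rpow_of_nonpos (by linarith) hσ0 (by linarith)) (hZ0 _)
        (abs_nonneg _) (Real.rpow_nonneg (by linarith) _)
    rw [show t2 - e - (t1 - e) = t2 - t1 by ring, abs_of_nonneg (a := t2 - t1) (by linarith)] at n2
    have n3 : (t1 - e) ^ (1 - α) / (1 - α) ≤ (d - e) ^ (1 - α) / (1 - α) :=
      div_le_div_of_nonneg_right (Real.rpow_le_rpow (by linarith) (by linarith) (by linarith)) (by linarith)
    have n4 := mul_le_mul_of_nonneg_right n3 (mul_nonneg hZ10 (sub_nonneg.2 h12))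
    refine (abs_add_le _ _).trans ?_
    linarith
  have b1 := (abs_le.1 hP).1
  have b2 := (abs_le.1 hN).1
  linarith

structure HSetup {H : Type*} [NormedAddCommGroup H] [InnerProductSpace ℝ H]
    (α T : ℝ) (w f : ℝ → H) (A : Submodule ℝ (H × H)) : Prop where
  h0 : 0 < α
  h1 : α < 1
  hT : 1 < T
  wc : Continuous w
  w0 : w 0 = 0
  f0 : ∀ t ≤ 1, f t = 0
  fT : ∀ t, T ≤ t → f t = f T
  cl : ∀ n : ℕ, IsClosed {t | ‖f t‖ ≤ n}
  wk : ∀ t1 t2 K : ℝ, 0 ≤ t1 → t1 ≤ t2 → t2 ≤ T → (∀ s ∈ Icc t1 t2, ‖f s‖ ≤ K) → ∀ η : H,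
    ContinuousOn (fun s => inner ℝ (f s) η) (Icc t1 t2) ∧
    (∫ s in (0:ℝ)..t2, (t2 - s) ^ (-α) * inner ℝ (w s) η)
      - (∫ s in (0:ℝ)..t1, (t1 - s) ^ (-α) * inner ℝ (w s) η)
      = ∫ s in t1..t2, inner ℝ (f s) η
  dis : ∀ p ∈ A, inner ℝ p.1 p.2 ≤ 0
  mem : ∀ t, (w t, f t) ∈ A

/-- the far-history field -/
noncomputable def hfar {H : Type*} [NormedAddCommGroup H] [InnerProductSpace ℝ H]
    (α c δ : ℝ) (w : ℝ → H) (t : ℝ) : H :=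
  (-α) • ∫ s in (0:ℝ)..c, (max (t - s) δ) ^ (-α - 1) • w s

section
variable {H : Type*} [NormedAddCommGroup H] [InnerProductSpace ℝ H] [CompleteSpace H]

theorem hfar_ii {α c δ : ℝ} (hδ : 0 < δ) {w : ℝ → H} (hw : Continuous w) (t : ℝ) :
    IntervalIntegrable (fun s => (max (t - s) δ) ^ (-α - 1) • w s) volume 0 c :=
  (((kcont hδ).comp (by fun_prop : Continuous fun s : ℝ => t - s)).smul hw).intervalIntegrable _ _

theorem hfar_inner {α c δ : ℝ} (hδ : 0 < δ) {w : ℝ → H} (hw : Continuous w) (t : ℝ) (η : H) :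
    inner ℝ (hfar α c δ w t) η
      = -α * ∫ s in (0:ℝ)..c, (max (t - s) δ) ^ (-α - 1) * inner ℝ (w s) η := by
  have := ContinuousLinearMap.intervalIntegral_comp_comm (innerSL ℝ η) (hfar_ii (α := α) (c := c) hδ hw t)
  simp only [innerSL_apply_apply] at this
  rw [hfar, inner_smul_left, real_inner_comm, ← this]
  simp only [conj_trivial]
  congr 1
  refine intervalIntegral.integral_congr fun s _ => ?_
  rw [inner_smul_right, real_inner_comm]

theorem hfar_bdd {α c δ : ℝ} (h0 : 0 < α) (hδ : 0 < δ) (hc : 0 ≤ c) {w : ℝ → H} (hw : Continuous w) :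
    ∃ M, ∀ t, ‖hfar α c δ w t‖ ≤ M := by
  obtain ⟨W, hW⟩ := (isCompact_Icc (a := (0:ℝ)) (b := c)).exists_bound_of_continuousOn hw.continuousOn
  refine ⟨α * (δ ^ (-α - 1) * W * |c - 0|), fun t => ?_⟩
  rw [hfar, norm_smul, norm_neg, Real.norm_of_nonneg h0.le]
  refine mul_le_mul_of_nonneg_left ?_ h0.le
  refine intervalIntegral.norm_integral_le_of_norm_le_const fun s hs => ?_
  rw [uIoc_of_le hc] at hs
  have hm : 0 < max (t - s) δ := lt_of_lt_of_le hδ (le_max_right _ _)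
  rw [norm_smul, Real.norm_of_nonneg (Real.rpow_nonneg hm.le _)]
  exact mul_le_mul (Real.rpow_le_rpow_of_nonpos hδ (le_max_right _ _) (by linarith))
    (hW s ⟨hs.1.le, hs.2⟩) (norm_nonneg _) (Real.rpow_nonneg hδ.le _)

theorem hfar_lip {α c δ : ℝ} (h0 : 0 < α) (hδ : 0 < δ) (hc : 0 ≤ c) {w : ℝ → H} (hw : Continuous w) :
    ∃ M, 0 ≤ M ∧ ∀ t t', ‖hfar α c δ w t - hfar α c δ w t'‖ ≤ M * |t - t'| := by
  obtain ⟨W, hW⟩ := (isCompact_Icc (a := (0:ℝ)) (b := c)).exists_bound_of_continuousOn hw.continuousOn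
  have hW0 : 0 ≤ W := (norm_nonneg _).trans (hW 0 ⟨le_rfl, hc⟩)
  refine ⟨α * ((α + 1) * δ ^ (-α - 2) * W * |c - 0|), ?_, fun t t' => ?_⟩
  · have := Real.rpow_nonneg hδ.le (-α - 2)
    positivity
  rw [hfar, hfar, ← smul_sub, norm_smul, norm_neg, Real.norm_of_nonneg h0.le,
    ← intervalIntegral.integral_sub (hfar_ii hδ hw t) (hfar_ii hδ hw t'), mul_assoc]
  refine mul_le_mul_of_nonneg_left ?_ h0.le
  have : (α + 1) * δ ^ (-α - 2) * W * |c - 0| * |t - t'|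
      = ((α + 1) * δ ^ (-α - 2) * |t - t'| * W) * |c - 0| := by ring
  rw [this]
  refine intervalIntegral.norm_integral_le_of_norm_le_const fun s hs => ?_
  rw [uIoc_of_le hc] at hs
  rw [← sub_smul, norm_smul, Real.norm_eq_abs]
  have kl := klip (β := -α - 1) (by linarith) hδ (t - s) (t' - s)
  rw [show t - s - (t' - s) = t - t' by ring, show -(-α - 1) = α + 1 by ring,
    show -α - 1 - 1 = -α - 2 by ring] at kl
  exact mul_le_mul kl (hW s ⟨hs.1.le, hs.2⟩) (norm_nonneg _) ((abs_nonneg _).trans kl)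

theorem win_bound {α T : ℝ} {w f : ℝ → H} {A : Submodule ℝ (H × H)} (hs : HSetup α T w f A)
    {c e e1 d K : ℝ} (hc : 0 ≤ c) (hce : c < e) (hee : e < e1) (hed : e1 ≤ d) (hdT : d ≤ T)
    (hK1 : ∀ t ∈ Icc c e1, ‖f t‖ ≤ K)
    (hK2 : ∀ t ∈ Icc e1 d, ‖f t‖ ≤ K ∨ ∃ ε > 0, ∃ K', ∀ s, |s - t| < ε → ‖f s‖ ≤ K') :
    ∃ M, ∀ l : ℝ, 0 < l → ∀ S : H →L[ℝ] H, (∀ Y, ‖S Y‖ ^ 2 ≤ inner ℝ (S Y) Y) →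
      (∀ p ∈ A, S (l • p.1 - p.2) = l • p.1) → ∀ t ∈ Icc e1 d, ‖S (f t)‖ ≤ M := by
  have h0 := hs.h0
  have h1 := hs.h1
  have hδ : 0 < e - c := by linarith
  set h := hfar α c (e - c) w with hh
  obtain ⟨Mh, hMh⟩ := hfar_bdd (α := α) h0 hδ hc hs.wc
  obtain ⟨Lh, hLh0, hLh⟩ := hfar_lip (α := α) h0 hδ hc hs.wc
  rw [← hh] at hMh hLh
  have hhc : Continuous h := by
    have : LipschitzWith ⟨Lh, hLh0⟩ h := LipschitzWith.of_dist_le_mul fun x y => by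
      rw [dist_eq_norm, dist_eq_norm]; exact hLh x y
    exact this.continuous
  have hK0 : 0 ≤ K := (norm_nonneg _).trans (hK1 c ⟨le_rfl, by linarith⟩)
  have hMh0 : 0 ≤ Mh := (norm_nonneg _).trans (hMh 0)
  set C5 := α * (e1 - e) ^ (-α - 1) * K * (e - c)
    + (Lh * ((d - e) ^ (1 - α) / (1 - α)) + (e1 - e) ^ (-α) * Mh) with hC5
  have hC50 : 0 ≤ C5 := by
    have i1 := Real.rpow_nonneg (show 0 ≤ e1 - e by linarith) (-α - 1)
    have i2 := Real.rpow_nonneg (show 0 ≤ e1 - e by linarith) (-α)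
    have i3 := Real.rpow_nonneg (show 0 ≤ d - e by linarith) (1 - α)
    have i4 : 0 < 1 - α := by linarith
    positivity
  refine ⟨K + Mh + C5 * (d - e) ^ α + Mh, ?_⟩
  intro l hl S hS1 hS2
  have hSn : ∀ Y, ‖S Y‖ ≤ ‖Y‖ := by
    intro Y
    have a1 := hS1 Y
    have a2 := real_inner_le_norm (S Y) Y
    rcases (norm_nonneg (S Y)).eq_or_lt with h' | h'
    · rw [← h']; exact norm_nonneg _
    · nlinarith
  have hSf : ∀ t, S (f t) = l • (S (w t) - w t) := by
    intro t
    have := hS2 _ (hs.mem t)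
    simp only [map_sub, map_smul] at this
    rw [smul_sub, ← this]; abel
  set y : ℝ → H := fun t => l • (S (w t) - w t) - S (h t) with hy
  have hyS : ∀ t, y t = S (f t - h t) := by
    intro t; rw [map_sub, hSf]
  have hyc : Continuous y := by
    have := hs.wc
    fun_prop
  obtain ⟨ts, hts, hmax⟩ := (isCompact_Icc (a := e) (b := d)).exists_isMaxOn
    ⟨e, le_rfl, by linarith⟩ (hyc.norm.continuousOn)
  have hpos : 0 ≤ (d - e) ^ α := Real.rpow_nonneg (by linarith) _
  have main : ‖y ts‖ ≤ K + Mh + C5 * (d - e) ^ α := by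
    have easy : ‖f ts‖ ≤ K → ‖y ts‖ ≤ K + Mh + C5 * (d - e) ^ α := by
      intro hf
      rw [hyS]
      have := (hSn (f ts - h ts)).trans (norm_sub_le _ _)
      have := hMh ts
      have := mul_nonneg hC50 hpos
      linarith
    rcases le_or_gt ts e1 with hle | hlt
    · exact easy (hK1 ts ⟨by linarith [hts.1], hle⟩)
    rcases hK2 ts ⟨hlt.le, hts.2⟩ with hf | ⟨ε0, hε0, K', hK'⟩
    · exact easy hf
    set η := y ts with hη
    rcases (norm_nonneg η).eq_or_lt with hz | hηp
    · rw [← hz]; have := mul_nonneg hC50 hpos; linarith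
    set η1 := l • (ContinuousLinearMap.adjoint S η - η) with hη1
    have hin : ∀ x, inner ℝ x η1 = inner ℝ (l • (S x - x)) η := by
      intro x
      rw [hη1, inner_smul_right, inner_sub_right, ContinuousLinearMap.adjoint_inner_right,
        inner_smul_left, inner_sub_left]
      simp
    set a0 := max e1 (ts - ε0 / 2) with ha0
    have ha0e : e1 ≤ a0 := le_max_left _ _
    have ha0t : a0 < ts := max_lt hlt (by linarith)
    have hfb : ∀ s ∈ Icc a0 ts, ‖f s‖ ≤ K' := by
      intro s hs'
      refine hK' s ?_
      have : ts - ε0 / 2 ≤ a0 := le_max_right _ _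
      rw [abs_lt]; constructor <;> linarith [hs'.1, hs'.2]
    have hwk := fun t1 t2 (h1' : a0 ≤ t1) (h2' : t1 ≤ t2) (h3' : t2 ≤ ts) =>
      hs.wk t1 t2 K' (by linarith) h2' (by linarith [hts.2])
        (fun s hs' => hfb s ⟨h1'.trans hs'.1, hs'.2.trans h3'⟩) η1
    have hIc : ContinuousOn (fun s => inner ℝ (f s) η1 - inner ℝ (h s) η1) (Icc a0 ts) :=
      (hwk a0 ts le_rfl ha0t.le le_rfl).1.sub (by fun_prop)
    have hIneg : inner ℝ (f ts) η1 - inner ℝ (h ts) η1 ≤ 0 := by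
      rw [← inner_sub_left, hin, hη, hyS, inner_smul_left, inner_sub_left, real_inner_self_eq_norm_sq]
      have := hS1 (f ts - h ts)
      rw [real_inner_comm] at this
      simp only [conj_trivial]
      exact mul_nonpos_of_nonneg_of_nonpos hl.le (by linarith)
    have hest : ∀ ε > 0, ‖η‖ ^ 2 * (ts - e) ^ (-α) ≤ ε + C5 * ‖η‖ := by
      intro ε hε
      have hev : ∀ᶠ s in 𝓝[Icc a0 ts] ts, inner ℝ (f s) η1 - inner ℝ (h s) η1 < ε :=
        (hIc ts ⟨ha0t.le, le_rfl⟩).eventually_lt_const (by linarith)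
      rw [eventually_nhdsWithin_iff, Metric.eventually_nhds_iff] at hev
      obtain ⟨r, hr, hr2⟩ := hev
      set a := max a0 (ts - r / 2) with ha
      have haa : a0 ≤ a := le_max_left _ _
      have hat : a < ts := max_lt ha0t (by linarith)
      have har : ts - r / 2 ≤ a := le_max_right _ _
      have hwη : Continuous fun s => inner ℝ (w s) η1 := by
        have := hs.wc
        fun_prop
      have hg : ∀ s, inner ℝ (w s) η1 - inner ℝ (S (h s)) η = inner ℝ (y s) η := by
        intro s; rw [hin, ← inner_sub_left]
      have hgb : inner ℝ (w ts) η1 - inner ℝ (S (h ts)) η = ‖η‖ ^ 2 := by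
        rw [hg, ← hη, real_inner_self_eq_norm_sq]
      have := scalar_est (q := fun s => inner ℝ (w s) η1) (ζ := fun s => inner ℝ (S (h s)) η)
        (c := c) (e := e) (e1 := e1) (a := a) (b := ts) (d := d) (Q := K * ‖η‖) (Z0 := Mh * ‖η‖)
        (Z1 := Lh * ‖η‖) (ε := ε) h0 h1 hwη (by fun_prop) hc hce.le hee (by linarith) hat hts.2
        ?_ ?_ ?_ ?_ ?_ ?_
      · rw [hgb] at this
        refine this.trans (le_of_eq ?_)
        rw [hC5]; ring
      · intro s hs'
        rw [hin, ← hSf]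
        refine (abs_real_inner_le_norm _ _).trans (mul_le_mul_of_nonneg_right ?_ (norm_nonneg _))
        exact (hSn _).trans (hK1 s ⟨hs'.1, by linarith [hs'.2]⟩)
      · intro s
        refine (abs_real_inner_le_norm _ _).trans (mul_le_mul_of_nonneg_right ?_ (norm_nonneg _))
        exact (hSn _).trans (hMh s)
      · intro s s'
        rw [← inner_sub_left, ← map_sub]
        refine (abs_real_inner_le_norm _ _).trans ?_
        have := mul_le_mul_of_nonneg_right ((hSn _).trans (hLh s s')) (norm_nonneg η)
        linarith
      · intro s hs'
        rw [hgb, hg]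
        refine (real_inner_le_norm _ _).trans ?_
        have := hmax (show s ∈ Icc e d from ⟨hs'.1, hs'.2.trans hts.2⟩)
        simp only [mem_setOf_eq, ← hη] at this
        nlinarith
      · skip
        rw [hgb]; positivity
      · intro t1 t2 i1 i2 i3
        rw [(hwk t1 t2 (haa.trans i1) i2 i3).2,
          kappa_inc (δ := e - c) hδ hc (by linarith) i2 hwη]
        have : ∀ τ, -α * ∫ s in (0:ℝ)..c, (max (τ - s) (e - c)) ^ (-α - 1) * inner ℝ (w s) η1
            = inner ℝ (h τ) η1 := fun τ => (hfar_inner hδ hs.wc τ η1).symm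
        simp only [this]
        have hci : ContinuousOn (fun s => inner ℝ (f s) η1) (Icc t1 t2) :=
          (hwk t1 t2 (haa.trans i1) i2 i3).1
        have hi1 : IntervalIntegrable (fun s => inner ℝ (f s) η1) volume t1 t2 := by
          refine ContinuousOn.intervalIntegrable ?_
          rwa [uIcc_of_le i2]
        have hi2 : IntervalIntegrable (fun s => inner ℝ (h s) η1) volume t1 t2 :=
          Continuous.intervalIntegrable (by fun_prop) _ _
        rw [← intervalIntegral.integral_sub hi1 hi2]
        have hm := intervalIntegral.integral_mono_on i2 (hi1.sub hi2) (_root_.intervalIntegrable_const (c := ε)) ?_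
        · rw [intervalIntegral.integral_const, smul_eq_mul] at hm
          linarith
        · intro s hs'
          refine (hr2 ?_ ⟨by linarith [hs'.1], by linarith [hs'.2]⟩).le
          rw [Real.dist_eq, abs_lt]
          constructor <;> linarith [hs'.1, hs'.2]
    have hest2 : ‖η‖ ^ 2 * (ts - e) ^ (-α) ≤ C5 * ‖η‖ :=
      le_of_forall_pos_le_add fun ε hε => by linarith [hest ε hε]
    have hte : 0 < ts - e := by linarith
    have hp := Real.rpow_pos_of_pos hte α
    have hest3 : ‖η‖ ≤ C5 * (ts - e) ^ α := by
      rw [Real.rpow_neg hte.le, ← div_eq_mul_inv, div_le_iff₀ hp] at hest2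
      nlinarith
    have hest4 : (ts - e) ^ α ≤ (d - e) ^ α :=
      Real.rpow_le_rpow hte.le (by linarith [hts.2]) h0.le
    have := mul_le_mul_of_nonneg_left hest4 hC50
    linarith
  intro t ht
  have e1 : S (f t) = y t + S (h t) := by rw [hyS, map_sub]; abel
  rw [e1]
  have m1 := hmax (show t ∈ Icc e d from ⟨by linarith [ht.1], ht.2⟩)
  simp only [mem_setOf_eq] at m1
  have := norm_add_le (y t) (S (h t))
  have := (hSn (h t)).trans (hMh t)
  linarith
end

section
variable {H : Type*} [NormedAddCommGroup H] [InnerProductSpace ℝ H] [CompleteSpace H]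

def GoodPt (f : ℝ → H) (t : ℝ) : Prop := ∃ ε > 0, ∃ K' : ℝ, ∀ s, |s - t| < ε → ‖f s‖ ≤ K'

theorem goodPt_open (f : ℝ → H) : IsOpen {t | GoodPt f t} := by
  rw [Metric.isOpen_iff]
  rintro t ⟨ε, hε, K, hK⟩
  refine ⟨ε / 2, by linarith, fun s hs => ⟨ε / 2, by linarith, K, fun r hr => hK r ?_⟩⟩
  rw [Metric.mem_ball, Real.dist_eq] at hs
  have := abs_add_le (r - s) (s - t)
  rw [sub_add_sub_cancel] at this
  linarith

theorem goodPt_dense {α T : ℝ} {w f : ℝ → H} {A : Submodule ℝ (H × H)} (hs : HSetup α T w f A) :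
    Dense {t | GoodPt f t} := by
  have hU : (⋃ n : ℕ, {t | ‖f t‖ ≤ n}) = univ := by
    refine eq_univ_of_forall fun t => ?_
    obtain ⟨n, hn⟩ := exists_nat_ge ‖f t‖
    exact mem_iUnion.2 ⟨n, hn⟩
  refine (dense_iUnion_interior_of_closed hs.cl hU).mono ?_
  refine iUnion_subset fun n t ht => ?_
  obtain ⟨ε, hε, hb⟩ := Metric.isOpen_iff.1 isOpen_interior t ht
  refine ⟨ε, hε, n, fun s hs' => ?_⟩
  have h2 : s ∈ {t | ‖f t‖ ≤ n} :=
    interior_subset (hb (by rwa [Metric.mem_ball, Real.dist_eq]))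
  exact h2

theorem good_perp {α T : ℝ} {w f : ℝ → H} {A : Submodule ℝ (H × H)} (hs : HSetup α T w f A)
    {t : ℝ} (ht0 : 0 < t) (htT : t ≤ T) (hg : GoodPt f t) (η : H) (hη : ∀ s, inner ℝ (w s) η = 0) :
    inner ℝ (f t) η ≤ 0 := by
  by_contra hcon
  push Not at hcon
  obtain ⟨ε, hε, K, hK⟩ := hg
  set a0 := max 0 (t - ε / 2) with ha0
  have h1 : 0 ≤ a0 := le_max_left _ _
  have h2 : t - ε / 2 ≤ a0 := le_max_right _ _
  have h3 : a0 < t := max_lt ht0 (by linarith)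
  have hb : ∀ s ∈ Icc a0 t, ‖f s‖ ≤ K := fun s hs' => hK s (by
    rw [abs_lt]; constructor <;> linarith [hs'.1, hs'.2])
  have hc := (hs.wk a0 t K h1 h3.le htT hb η).1
  have hev : ∀ᶠ s in 𝓝[Icc a0 t] t, inner ℝ (f t) η / 2 < inner ℝ (f s) η :=
    (hc t ⟨h3.le, le_rfl⟩).eventually_const_lt (by linarith)
  rw [eventually_nhdsWithin_iff, Metric.eventually_nhds_iff] at hev
  obtain ⟨r, hr, hr2⟩ := hev
  set a := max a0 (t - r / 2) with ha
  have haa : a0 ≤ a := le_max_left _ _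
  have hat : a < t := max_lt h3 (by linarith)
  have har : t - r / 2 ≤ a := le_max_right _ _
  have hw := hs.wk a t K (h1.trans haa) hat.le htT (fun s hs' => hb s ⟨haa.trans hs'.1, hs'.2⟩) η
  have hi : IntervalIntegrable (fun s => inner ℝ (f s) η) volume a t := by
    refine ContinuousOn.intervalIntegrable ?_
    rw [uIcc_of_le hat.le]; exact hw.1
  have h4 := hw.2
  simp only [hη, mul_zero, intervalIntegral.integral_zero, sub_zero] at h4
  have hm := intervalIntegral.integral_mono_on hat.le
    (_root_.intervalIntegrable_const (c := inner ℝ (f t) η / 2)) hi ?_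
  · rw [intervalIntegral.integral_const, smul_eq_mul, ← h4] at hm
    have : 0 < (t - a) * (inner ℝ (f t) η / 2) := mul_pos (by linarith) (by linarith)
    linarith
  · intro s hs'
    refine (hr2 ?_ ⟨by linarith [hs'.1], by linarith [hs'.2]⟩).le
    rw [Real.dist_eq, abs_lt]
    constructor <;> linarith [hs'.1, hs'.2]

theorem good_mem {α T : ℝ} {w f : ℝ → H} {A : Submodule ℝ (H × H)} (hs : HSetup α T w f A)
    {t : ℝ} (ht0 : 0 < t) (htT : t ≤ T) (hg : GoodPt f t) :
    f t ∈ (Submodule.span ℝ (range w)).topologicalClosure := by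
  rw [← Submodule.orthogonal_orthogonal_eq_closure, Submodule.mem_orthogonal]
  intro η hη
  rw [Submodule.mem_orthogonal] at hη
  have hw : ∀ s, inner ℝ (w s) η = 0 := fun s => hη _ (Submodule.subset_span ⟨s, rfl⟩)
  have a1 := good_perp hs ht0 htT hg η hw
  have a2 := good_perp hs ht0 htT hg (-η) (fun s => by rw [inner_neg_right, hw, neg_zero])
  rw [inner_neg_right] at a2
  rw [real_inner_comm]
  linarith

theorem good_all {α T : ℝ} {w f : ℝ → H} {A : Submodule ℝ (H × H)} (hs : HSetup α T w f A) :
    ∀ t, GoodPt f t := by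
  by_contra hcon
  push Not at hcon
  obtain ⟨b0, hb0⟩ := hcon
  set B : Set ℝ := {t | GoodPt f t}ᶜ with hB
  have hBc : IsClosed B := (goodPt_open f).isClosed_compl
  have : CompleteSpace B := hBc.completeSpace_coe
  have : Nonempty B := ⟨⟨b0, hb0⟩⟩
  obtain ⟨n, ⟨b, hbB⟩, hbn⟩ : ∃ n : ℕ, (interior {x : B | ‖f x.1‖ ≤ n}).Nonempty := by
    refine nonempty_interior_of_iUnion_of_closed (fun n => (hs.cl n).preimage continuous_subtype_val) ?_
    refine eq_univ_of_forall fun t => ?_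
    obtain ⟨n, hn⟩ := exists_nat_ge ‖f t.1‖
    exact mem_iUnion.2 ⟨n, hn⟩
  obtain ⟨ε, hε, hball⟩ := Metric.isOpen_iff.1 isOpen_interior _ hbn
  have hBn : ∀ s ∈ B, |s - b| < ε → ‖f s‖ ≤ n := fun s hsB hsb => by
    have h2 : (⟨s, hsB⟩ : B) ∈ {x : B | ‖f x.1‖ ≤ n} :=
      interior_subset (hball (show (⟨s, hsB⟩ : B) ∈ _ by
        rw [Metric.mem_ball, Subtype.dist_eq, Real.dist_eq]; exact hsb))
    exact h2
  have hb1 : 1 ≤ b := by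
    by_contra h
    push Not at h
    refine hbB ⟨1 - b, by linarith, 0, fun s hs' => ?_⟩
    rw [hs.f0 s (by linarith [(abs_lt.1 hs').2]), norm_zero]
  have hbT : b ≤ T := by
    by_contra h
    push Not at h
    refine hbB ⟨b - T, by linarith, ‖f T‖, fun s hs' => ?_⟩
    rw [hs.fT s (by linarith [(abs_lt.1 hs').1])]
  obtain ⟨c, hcI, hcg⟩ := (goodPt_dense hs).inter_open_nonempty (Ioo (max (b - ε) 0) b) isOpen_Ioo
    ⟨(max (b - ε) 0 + b) / 2, by
      have : max (b - ε) 0 < b := max_lt (by linarith) (by linarith)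
      constructor <;> linarith⟩
  have hc0 : 0 < c := lt_of_le_of_lt (le_max_right _ _) hcI.1
  have hcε : b - ε < c := lt_of_le_of_lt (le_max_left _ _) hcI.1
  have hcb : c < b := hcI.2
  obtain ⟨ε1, hε1, K1, hK1⟩ := hcg
  set ρ := min ε1 (b - c) / 4 with hρ
  have hρ0 : 0 < ρ := by
    have : 0 < min ε1 (b - c) := lt_min hε1 (by linarith)
    positivity
  have hρ1 : 4 * ρ ≤ ε1 := by rw [hρ]; linarith [min_le_left ε1 (b - c)]
  have hρ2 : 4 * ρ ≤ b - c := by rw [hρ]; linarith [min_le_right ε1 (b - c)]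
  set d := min (b + ε / 2) T with hd
  have hd1 : d ≤ b + ε / 2 := min_le_left _ _
  have hd2 : d ≤ T := min_le_right _ _
  have hd3 : b ≤ d := le_min (by linarith) hbT
  obtain ⟨M, hM⟩ := win_bound hs (c := c) (e := c + ρ) (e1 := c + 2 * ρ) (d := d) (K := max K1 n)
    hc0.le (by linarith) (by linarith) (by linarith) hd2
    (fun t ht => (hK1 t (by rw [abs_lt]; constructor <;> linarith [ht.1, ht.2])).trans (le_max_left _ _))
    (fun t ht => by
      by_cases hg : GoodPt f t
      · exact Or.inr hg
      · refine Or.inl ((hBn t hg ?_).trans (le_max_right _ _))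
        rw [abs_lt]; constructor <;> linarith [ht.1, ht.2])
  have hex : ∀ N : ℕ, ∃ S : H →L[ℝ] H, (∀ Y, ‖S Y‖ ^ 2 ≤ inner ℝ (S Y) Y) ∧
      ∀ p ∈ A, S (((N : ℝ) + 1) • p.1 - p.2) = ((N : ℝ) + 1) • p.1 := fun N =>
    cayley A hs.dis (by positivity)
  choose S hS1 hS2 using hex
  have hSn : ∀ N Y, ‖S N Y‖ ≤ ‖Y‖ := by
    intro N Y
    have a1 := hS1 N Y
    have a2 := real_inner_le_norm (S N Y) Y
    rcases (norm_nonneg (S N Y)).eq_or_lt with h' | h'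
    · rw [← h']; exact norm_nonneg _
    · nlinarith
  let V : Submodule ℝ H :=
    { carrier := {Y | Tendsto (fun N => S N Y) atTop (𝓝 Y)}
      add_mem' := fun {x y} hx hy => by
        have : Tendsto (fun N => S N x + S N y) atTop (𝓝 (x + y)) := Tendsto.add hx hy
        simpa using this
      zero_mem' := by simp
      smul_mem' := fun r x hx => by
        have : Tendsto (fun N => r • S N x) atTop (𝓝 (r • x)) := Tendsto.const_smul hx r
        simpa using this }
  have hVmem : ∀ Y, Y ∈ V ↔ Tendsto (fun N => S N Y) atTop (𝓝 Y) := fun Y => Iff.rfl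
  have hVw : Submodule.span ℝ (range w) ≤ V := by
    rw [Submodule.span_le]
    rintro _ ⟨s, rfl⟩
    change w s ∈ V
    rw [hVmem, tendsto_iff_norm_sub_tendsto_zero]
    have hb : ∀ N, ‖S N (w s) - w s‖ ≤ ‖f s‖ / ((N : ℝ) + 1) := by
      intro N
      have h1 := hS2 N _ (hs.mem s)
      simp only [map_sub, map_smul] at h1
      have h2 : ((N : ℝ) + 1) • (S N (w s) - w s) = S N (f s) := by
        rw [smul_sub, ← h1]; abel
      have h3 : ‖((N : ℝ) + 1) • (S N (w s) - w s)‖ ≤ ‖f s‖ := by rw [h2]; exact hSn N _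
      rw [norm_smul, Real.norm_of_nonneg (by positivity)] at h3
      rw [le_div_iff₀ (by positivity)]; linarith
    refine squeeze_zero (fun N => norm_nonneg _) hb ?_
    exact tendsto_const_nhds.div_atTop
      (tendsto_atTop_add_const_right _ _ tendsto_natCast_atTop_atTop)
  have hVc : ∀ Y ∈ (Submodule.span ℝ (range w)).topologicalClosure, Y ∈ V := by
    intro Y hY
    rw [hVmem, Metric.tendsto_atTop]
    intro r hr
    obtain ⟨Z, hZ, hYZ⟩ := Metric.mem_closure_iff.1 (show Y ∈ closure _ from hY) (r / 3) (by linarith)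
    have hZV := hVw hZ
    rw [hVmem, Metric.tendsto_atTop] at hZV
    obtain ⟨N0, hN0⟩ := hZV (r / 3) (by linarith)
    refine ⟨N0, fun N hN => ?_⟩
    have h1 := hN0 N hN
    have h2 := hSn N (Y - Z)
    rw [map_sub, ← dist_eq_norm, ← dist_eq_norm] at h2
    have h3 := dist_triangle4 (S N Y) (S N Z) Z Y
    rw [dist_comm Z Y] at h3
    linarith
  have hfin : ∀ t ∈ Icc (c + 2 * ρ) d, ‖f t‖ ≤ max M n := by
    intro t ht
    by_cases hg : GoodPt f t
    · have hm := hVc _ (good_mem hs (by linarith [ht.1]) (by linarith [ht.2]) hg)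
      rw [hVmem] at hm
      refine le_trans (le_of_tendsto hm.norm ?_) (le_max_left _ _)
      refine Eventually.of_forall fun N => ?_
      exact hM _ (by positivity) (S N) (hS1 N) (hS2 N) t ht
    · refine (hBn t hg ?_).trans (le_max_right _ _)
      rw [abs_lt]; constructor <;> linarith [ht.1, ht.2]
  refine hbB ⟨min ρ (ε / 2), lt_min hρ0 (by linarith), max M n, fun s hs' => ?_⟩
  have q1 := (abs_lt.1 hs').1
  have q2 := (abs_lt.1 hs').2
  have q3 := min_le_left ρ (ε / 2)
  have q4 := min_le_right ρ (ε / 2)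
  rcases le_or_gt s T with hsT | hsT
  · exact hfin s ⟨by linarith, le_min (by linarith) hsT⟩
  · rw [hs.fT s hsT.le]
    exact hfin T ⟨by linarith, le_min (by linarith) le_rfl⟩

theorem hilbert_zero {α T : ℝ} {w f : ℝ → H} {A : Submodule ℝ (H × H)} (hs : HSetup α T w f A) :
    ∀ t ∈ Icc 0 T, w t = 0 := by
  have h0 := hs.h0
  obtain ⟨K, hK⟩ : ∃ K, ∀ s ∈ Icc 0 T, ‖f s‖ ≤ K := by
    refine (isCompact_Icc (a := (0:ℝ)) (b := T)).induction_on (p := fun S => ∃ K, ∀ s ∈ S, ‖f s‖ ≤ K)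
      ⟨0, by simp⟩ ?_ ?_ ?_
    · rintro s t hst ⟨K, hK⟩
      exact ⟨K, fun x hx => hK x (hst hx)⟩
    · rintro s t ⟨K, hK⟩ ⟨K', hK'⟩
      refine ⟨max K K', fun x hx => ?_⟩
      rcases hx with hx | hx
      · exact (hK x hx).trans (le_max_left _ _)
      · exact (hK' x hx).trans (le_max_right _ _)
    · intro x _
      obtain ⟨ε, hε, K, hK⟩ := good_all hs x
      refine ⟨Metric.ball x ε, mem_nhdsWithin_of_mem_nhds (Metric.ball_mem_nhds x hε), K, fun s hs' => hK s ?_⟩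
      rwa [Metric.mem_ball, Real.dist_eq] at hs'
  have hT := hs.hT
  obtain ⟨ts, hts, hmax⟩ := (isCompact_Icc (a := (0:ℝ)) (b := T)).exists_isMaxOn
    ⟨0, le_rfl, by linarith⟩ (hs.wc.norm.continuousOn)
  suffices hz : ‖w ts‖ = 0 by
    intro t ht
    have := hmax ht
    simp only [mem_setOf_eq, hz] at this
    exact norm_le_zero_iff.1 this
  by_contra hne
  have hηp : 0 < ‖w ts‖ := lt_of_le_of_ne (norm_nonneg _) (Ne.symm hne)
  have hts0 : 0 < ts := by
    rcases hts.1.eq_or_lt with h | h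
    · rw [← h, hs.w0, norm_zero] at hne; exact absurd rfl hne
    · exact h
  set η := w ts with hη
  have hwη : Continuous fun s => inner ℝ (w s) η := by
    have := hs.wc
    fun_prop
  have hwk := fun t1 t2 (h1' : 0 ≤ t1) (h2' : t1 ≤ t2) (h3' : t2 ≤ ts) =>
    hs.wk t1 t2 K h1' h2' (by linarith [hts.2])
      (fun s hs' => hK s ⟨h1'.trans hs'.1, hs'.2.trans (h3'.trans hts.2)⟩) η
  have hIneg : inner ℝ (f ts) η ≤ 0 := by
    have := hs.dis _ (hs.mem ts)
    rwa [real_inner_comm] at this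
  have hest : ∀ ε > 0, ‖η‖ ^ 2 * ts ^ (-α) ≤ ε := by
    intro ε hε
    have hev : ∀ᶠ s in 𝓝[Icc 0 ts] ts, inner ℝ (f s) η < ε :=
      ((hwk 0 ts le_rfl hts0.le le_rfl).1 ts ⟨hts0.le, le_rfl⟩).eventually_lt_const (by linarith)
    rw [eventually_nhdsWithin_iff, Metric.eventually_nhds_iff] at hev
    obtain ⟨r, hr, hr2⟩ := hev
    set a := max 0 (ts - r / 2) with ha
    have haa : 0 ≤ a := le_max_left _ _
    have hat : a < ts := max_lt hts0 (by linarith)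
    have har : ts - r / 2 ≤ a := le_max_right _ _
    have := frac_max (g := fun s => inner ℝ (w s) η) (e := 0) (a := a) (b := ts) (R := ε) h0 hs.h1 hwη
      haa hat ?_ ?_ ?_
    · rw [← hη, real_inner_self_eq_norm_sq, sub_zero] at this
      exact this
    · intro s hs'
      rw [← hη, real_inner_self_eq_norm_sq]
      refine (real_inner_le_norm _ _).trans ?_
      have := hmax (show s ∈ Icc 0 T from ⟨hs'.1, hs'.2.trans hts.2⟩)
      simp only [mem_setOf_eq, ← hη] at this
      nlinarith
    · rw [← hη, real_inner_self_eq_norm_sq]; positivity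
    · intro t1 t2 i1 i2 i3
      have hw := hwk t1 t2 (haa.trans i1) i2 i3
      rw [hw.2]
      have hi1 : IntervalIntegrable (fun s => inner ℝ (f s) η) volume t1 t2 := by
        refine ContinuousOn.intervalIntegrable ?_
        rw [uIcc_of_le i2]; exact hw.1
      have hm := intervalIntegral.integral_mono_on i2 hi1 (_root_.intervalIntegrable_const (c := ε)) ?_
      · rw [intervalIntegral.integral_const, smul_eq_mul] at hm
        linarith
      · intro s hs'
        refine (hr2 ?_ ⟨by linarith [hs'.1], by linarith [hs'.2]⟩).le
        rw [Real.dist_eq, abs_lt]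
        constructor <;> linarith [hs'.1, hs'.2]
  have hp : 0 < ‖η‖ ^ 2 * ts ^ (-α) := mul_pos (by positivity) (Real.rpow_pos_of_pos hts0 _)
  linarith [hest (‖η‖ ^ 2 * ts ^ (-α) / 2) (by linarith)]
end

structure PSetup {X : Type*} [MeasurableSpace X] (μ : Measure X) (α T : ℝ) (w f : X → ℝ → ℝ) :
    Prop where
  h0 : 0 < α
  h1 : α < 1
  hT : 1 < T
  wc : ∀ x, Continuous (w x)
  fc : ∀ x, Continuous (f x)
  wm : ∀ t, Measurable (fun x => w x t)
  fm : ∀ t, Measurable (fun x => f x t)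
  wb : ∃ M, ∀ x t, |w x t| ≤ M
  fb : ∀ t, ∃ M, ∀ x, |f x t| ≤ M
  w0 : ∀ x, w x 0 = 0
  f0 : ∀ x, ∀ t ≤ 1, f x t = 0
  fT : ∀ x t, T ≤ t → f x t = f x T
  idn : ∀ x, ∀ t ∈ Icc 0 T, ∫ s in (0:ℝ)..t, (t - s) ^ (-α) * w x s = ∫ s in (0:ℝ)..t, f x s

section
variable {X : Type*} [MeasurableSpace X] {μ : Measure X} [IsFiniteMeasure μ] {α T : ℝ}
  {w f : X → ℝ → ℝ}

theorem inner_toLp {g : X → ℝ} (hg : MemLp g 2 μ) (η : Lp ℝ 2 μ) :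
    inner ℝ (hg.toLp g) η = ∫ x, g x * η x ∂μ := by
  rw [L2.inner_def]
  refine integral_congr_ae ?_
  filter_upwards [hg.coeFn_toLp] with x hx
  rw [hx]; simp [mul_comm]

theorem normsq_toLp {g : X → ℝ} (hg : MemLp g 2 μ) :
    ‖hg.toLp g‖ ^ 2 = ∫ x, g x ^ 2 ∂μ := by
  rw [← real_inner_self_eq_norm_sq, inner_toLp]
  refine integral_congr_ae ?_
  filter_upwards [hg.coeFn_toLp] with x hx
  rw [hx]; ring

theorem toLp_zero' {g : X → ℝ} (hg : MemLp g 2 μ) (h : ∀ x, g x = 0) : hg.toLp g = 0 := by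
  have : g = 0 := funext h
  subst this
  exact MemLp.toLp_zero _

theorem PSetup.wM (h : PSetup μ α T w f) (t : ℝ) : MemLp (fun x => w x t) 2 μ := by
  obtain ⟨M, hM⟩ := h.wb
  exact MemLp.of_bound (h.wm t).aestronglyMeasurable M (ae_of_all _ fun x => hM x t)

theorem PSetup.fM (h : PSetup μ α T w f) (t : ℝ) : MemLp (fun x => f x t) 2 μ := by
  obtain ⟨M, hM⟩ := h.fb t
  exact MemLp.of_bound (h.fm t).aestronglyMeasurable M (ae_of_all _ fun x => hM x)

theorem PSetup.wH_cont (h : PSetup μ α T w f) : Continuous (fun t => (h.wM t).toLp _) := by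
  obtain ⟨M, hM⟩ := h.wb
  rw [continuous_iff_continuousAt]
  intro t0
  have h1 : Continuous (fun t => ∫ x, (w x t - w x t0) ^ 2 ∂μ) := by
    refine continuous_of_dominated (bound := fun _ => (2 * M) ^ 2) ?_ ?_ (integrable_const _) ?_
    · intro t; exact (((h.wm t).sub (h.wm t0)).pow_const 2).aestronglyMeasurable
    · intro t; refine ae_of_all _ fun x => ?_
      rw [norm_pow]
      refine pow_le_pow_left₀ (norm_nonneg _) ?_ 2
      calc ‖w x t - w x t0‖ ≤ |w x t| + |w x t0| := norm_sub_le _ _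
        _ ≤ _ := by linarith [hM x t, hM x t0]
    · refine ae_of_all _ fun x => ?_
      exact ((h.wc x).sub continuous_const).pow 2
  have h2 : ∀ t, ‖(h.wM t).toLp _ - (h.wM t0).toLp _‖ ^ 2 = ∫ x, (w x t - w x t0) ^ 2 ∂μ := by
    intro t
    rw [← MemLp.toLp_sub, normsq_toLp]; rfl
  have h3 : Tendsto (fun t => ‖(h.wM t).toLp _ - (h.wM t0).toLp _‖ ^ 2) (𝓝 t0) (𝓝 0) := by
    simp only [h2]
    have := h1.tendsto t0
    simpa using this
  have h4 := h3.sqrt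
  simp only [Real.sqrt_sq (norm_nonneg _), Real.sqrt_zero] at h4
  exact tendsto_iff_norm_sub_tendsto_zero.2 h4

theorem PSetup.cl (h : PSetup μ α T w f) (n : ℕ) : IsClosed {t | ‖(h.fM t).toLp _‖ ≤ n} := by
  refine IsSeqClosed.isClosed ?_
  intro s t hs hst
  simp only [mem_setOf_eq] at hs ⊢
  have hle : ∀ i, eLpNorm (fun x => f x (s i)) 2 μ ≤ (n : ENNReal) := by
    intro i
    have := hs i
    rw [Lp.norm_toLp] at this
    have h2 := ENNReal.ofReal_le_ofReal this
    rwa [ENNReal.ofReal_toReal (h.fM _).2.ne, ENNReal.ofReal_natCast] at h2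
  have := Lp.eLpNorm_lim_le_liminf_eLpNorm (p := 2) (μ := μ) (f := fun i x => f x (s i))
    (fun i => (h.fM _).1) (fun x => f x t)
    (ae_of_all _ fun x => ((h.fc x).tendsto t).comp hst)
  have h3 : eLpNorm (fun x => f x t) 2 μ ≤ n :=
    this.trans (Filter.liminf_le_of_frequently_le' (Frequently.of_forall hle))
  rw [Lp.norm_toLp]
  have := ENNReal.toReal_mono (by simp) h3
  simpa using this

theorem PSetup.wkc (h : PSetup μ α T w f) {t1 t2 K : ℝ} (h12 : t1 ≤ t2)
    (hK : ∀ s ∈ Icc t1 t2, ‖(h.fM s).toLp _‖ ≤ K) (η : Lp ℝ 2 μ) :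
    ContinuousOn (fun s => inner ℝ ((h.fM s).toLp _) η) (Icc t1 t2) := by
  have hK0 : 0 ≤ K := (norm_nonneg _).trans (hK t1 ⟨le_rfl, h12⟩)
  let c : ℝ → ℝ := fun s => max t1 (min s t2)
  have hc : Continuous c := by fun_prop
  have hcm : ∀ s, c s ∈ Icc t1 t2 := fun s => ⟨le_max_left _ _, max_le h12 (min_le_right _ _)⟩
  have hci : ∀ s ∈ Icc t1 t2, c s = s := fun s hs => by
    simp only [c]; rw [min_eq_left hs.2, max_eq_right hs.1]
  let E : ℕ → Set X := fun k => {x | ∀ q : ℚ, |f x (c q)| ≤ k}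
  have hE : ∀ k, MeasurableSet (E k) := by
    intro k
    simp only [E, setOf_forall]
    refine MeasurableSet.iInter fun q => ?_
    exact measurableSet_le (h.fm _).abs measurable_const
  have hEb : ∀ k, ∀ x ∈ E k, ∀ s ∈ Icc t1 t2, |f x s| ≤ k := by
    intro k x hx s hs
    have : ∀ r : ℝ, |f x (c r)| ≤ k := by
      intro r
      refine Rat.denseRange_cast.induction_on (p := fun r : ℝ => |f x (c r)| ≤ k) r ?_ hx
      exact isClosed_le ((h.fc x).comp hc).abs continuous_const
    simpa [hci s hs] using this s
  have hEu : ∀ x, ∀ᶠ k in atTop, x ∈ E k := by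
    intro x
    obtain ⟨M, hM⟩ := (isCompact_Icc (a := t1) (b := t2)).exists_bound_of_continuousOn
      (h.fc x).continuousOn
    obtain ⟨N, hN⟩ := exists_nat_ge M
    filter_upwards [eventually_ge_atTop N] with k hk q
    refine (hM _ (hcm q)).trans (hN.trans (by exact_mod_cast hk))
  have hηM : MemLp (η : X → ℝ) 2 μ := Lp.memLp η
  have hkM : ∀ k, MemLp ((E k).indicator η) 2 μ := fun k => hηM.indicator (hE k)
  let ηk : ℕ → Lp ℝ 2 μ := fun k => (hkM k).toLp _
  have hsq : Integrable (fun x => η x ^ 2) μ := hηM.integrable_sq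
  have hlim : Tendsto (fun k => ‖η - ηk k‖) atTop (𝓝 0) := by
    have e1 : ∀ k, ‖η - ηk k‖ ^ 2 = ∫ x, (η x - (E k).indicator η x) ^ 2 ∂μ := by
      intro k
      have : η - ηk k = (hηM.sub (hkM k)).toLp _ := by
        rw [MemLp.toLp_sub hηM (hkM k), Lp.toLp_coeFn η hηM]
      rw [this, normsq_toLp]; rfl
    have e2 : Tendsto (fun k => ∫ x, (η x - (E k).indicator η x) ^ 2 ∂μ) atTop
        (𝓝 (∫ x, (0:ℝ) ∂μ)) := by
      refine tendsto_integral_of_dominated_convergence (fun x => η x ^ 2) ?_ hsq ?_ ?_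
      · intro k
        exact ((hηM.1.sub (hkM k).1).pow 2)
      · intro k; refine ae_of_all _ fun x => ?_
        by_cases hx : x ∈ E k
        · simp [hx, sq_nonneg]
        · simp [hx]
      · refine ae_of_all _ fun x => ?_
        refine tendsto_const_nhds.congr' ?_
        filter_upwards [hEu x] with k hk
        simp [hk]
    simp only [integral_zero, ← e1] at e2
    have := e2.sqrt
    simpa only [Real.sqrt_sq (norm_nonneg _), Real.sqrt_zero] using this
  have hck : ∀ k, ContinuousOn (fun s => inner ℝ ((h.fM s).toLp _) (ηk k)) (Icc t1 t2) := by
    intro k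
    have e1 : ∀ s, inner ℝ ((h.fM s).toLp _) (ηk k)
        = ∫ x, f x s * (E k).indicator η x ∂μ := by
      intro s
      rw [inner_toLp]
      refine integral_congr_ae ?_
      filter_upwards [(hkM k).coeFn_toLp] with x hx
      simp only [ηk]; rw [hx]
    simp only [e1]
    refine continuousOn_of_dominated (bound := fun x => k * ‖η x‖) ?_ ?_ ?_ ?_
    · intro s _; exact (h.fM s).1.mul (hkM k).1
    · intro s hs; refine ae_of_all _ fun x => ?_
      by_cases hx : x ∈ E k
      · simp only [indicator_of_mem hx, norm_mul]
        exact mul_le_mul_of_nonneg_right (hEb k x hx s hs) (norm_nonneg _)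
      · simp only [indicator_of_notMem hx]; simp; positivity
    · exact ((hηM.integrable (by norm_num)).norm.const_mul _)
    · refine ae_of_all _ fun x => ?_
      exact ((h.fc x).mul continuous_const).continuousOn
  refine TendstoUniformlyOn.continuousOn
    (F := fun k s => inner ℝ ((h.fM s).toLp _) (ηk k)) (p := atTop) ?_ (Frequently.of_forall hck)
  rw [Metric.tendstoUniformlyOn_iff]
  intro ε hε
  have : Tendsto (fun k => K * ‖η - ηk k‖) atTop (𝓝 0) := by simpa using hlim.const_mul K
  filter_upwards [this.eventually (gt_mem_nhds hε)] with k hk s hs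
  rw [Real.dist_eq, ← inner_sub_right]
  refine (abs_real_inner_le_norm _ _).trans_lt (lt_of_le_of_lt ?_ hk)
  exact mul_le_mul_of_nonneg_right (hK s hs) (norm_nonneg _)

theorem PSetup.jm {f : X → ℝ → ℝ} (fc : ∀ x, Continuous (f x))
    (fm : ∀ t, Measurable (fun x => f x t)) : 
    StronglyMeasurable (fun p : ℝ × X => f p.2 p.1) :=
  stronglyMeasurable_uncurry_of_continuous_of_stronglyMeasurable (u := fun t x => f x t) fc
    (fun t => (fm t).stronglyMeasurable)

theorem PSetup.wk1 (h : PSetup μ α T w f) {t : ℝ} (ht : t ∈ Icc 0 T) (η : Lp ℝ 2 μ) :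
    Integrable (fun x => (∫ s in (0:ℝ)..t, f x s) * η x) μ ∧
    ∫ s in (0:ℝ)..t, (t - s) ^ (-α) * inner ℝ ((h.wM s).toLp _) η
      = ∫ x, (∫ s in (0:ℝ)..t, f x s) * η x ∂μ := by
  obtain ⟨M, hM⟩ := h.wb
  have hγ : -1 < -α := by linarith [h.h1]
  have hη : Integrable (η : X → ℝ) μ := (Lp.memLp η).integrable (by norm_num)
  have hint : Integrable (Function.uncurry fun (s : ℝ) (x : X) => (t - s) ^ (-α) * (w x s * η x))
      ((volume.restrict (uIoc 0 t)).prod μ) := by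
    have hk : Integrable (fun s => (t - s) ^ (-α)) (volume.restrict (uIoc 0 t)) :=
      intervalIntegrable_iff.1 (ker_ii hγ t 0 t)
    have hd := (hk.mul_prod hη).norm.const_mul M
    refine hd.mono' ?_ ?_
    · refine AEStronglyMeasurable.mul (hk.1.comp_fst) ?_
      exact (PSetup.jm h.wc h.wm).aestronglyMeasurable.mul hη.1.comp_snd
    · refine ae_of_all _ fun p => ?_
      simp only [Function.uncurry, norm_mul]
      have := hM p.2 p.1
      rw [← Real.norm_eq_abs] at this
      have h2 : 0 ≤ ‖(t - p.1) ^ (-α)‖ * ‖η p.2‖ := by positivity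
      nlinarith
  have heq : ∀ x, ∫ s in (0:ℝ)..t, (t - s) ^ (-α) * (w x s * η x)
      = (∫ s in (0:ℝ)..t, f x s) * η x := by
    intro x
    rw [← h.idn x t ht, ← intervalIntegral.integral_mul_const]
    refine intervalIntegral.integral_congr fun s _ => ?_
    ring
  constructor
  · have := hint.integral_prod_right
    refine this.congr (ae_of_all _ fun x => ?_)
    refine Eq.trans ?_ (heq x)
    rw [intervalIntegral.integral_of_le ht.1, uIoc_of_le ht.1]; rfl
  · simp only [← heq]
    rw [← intervalIntegral_integral_swap hint]
    refine intervalIntegral.integral_congr fun s _ => ?_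
    simp only [inner_toLp, integral_const_mul]

theorem PSetup.wki (h : PSetup μ α T w f) {t1 t2 K : ℝ} (h01 : 0 ≤ t1) (h12 : t1 ≤ t2)
    (h2T : t2 ≤ T)
    (hK : ∀ s ∈ Icc t1 t2, ‖(h.fM s).toLp _‖ ≤ K) (η : Lp ℝ 2 μ) :
    (∫ s in (0:ℝ)..t2, (t2 - s) ^ (-α) * inner ℝ ((h.wM s).toLp _) η)
      - (∫ s in (0:ℝ)..t1, (t1 - s) ^ (-α) * inner ℝ ((h.wM s).toLp _) η)
      = ∫ s in t1..t2, inner ℝ ((h.fM s).toLp _) η := by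
  have hK0 : 0 ≤ K := (norm_nonneg _).trans (hK t1 ⟨le_rfl, h12⟩)
  have a1 := h.wk1 ⟨h01, h12.trans h2T⟩ η
  have a2 := h.wk1 ⟨h01.trans h12, h2T⟩ η
  have hηM : MemLp (η : X → ℝ) 2 μ := Lp.memLp η
  have hηi := hηM.integrable_sq
  rw [a1.2, a2.2, ← integral_sub a2.1 a1.1]
  have hint : Integrable (Function.uncurry fun (s : ℝ) (x : X) => f x s * η x)
      ((volume.restrict (uIoc t1 t2)).prod μ) := by
    have hms : AEStronglyMeasurable (Function.uncurry fun (s : ℝ) (x : X) => f x s * η x)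
      ((volume.restrict (uIoc t1 t2)).prod μ) :=
      (PSetup.jm h.fc h.fm).aestronglyMeasurable.mul hηM.1.comp_snd
    rw [integrable_prod_iff hms]
    have hmul : ∀ s, Integrable (fun x => f x s * η x) μ := fun s =>
      (h.fM s).integrable_mul hηM
    refine ⟨ae_of_all _ hmul, ?_⟩
    haveI : IsFiniteMeasure ((volume : Measure ℝ).restrict (uIoc t1 t2)) := by
      rw [uIoc_of_le h12]; infer_instance
    refine Integrable.of_bound hms.norm.integral_prod_right' ((K ^ 2 + ∫ x, η x ^ 2 ∂μ) / 2) ?_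
    refine (ae_restrict_iff' measurableSet_uIoc).2 (ae_of_all _ fun s hs => ?_)
    rw [uIoc_of_le h12] at hs
    have hs' := hK s ⟨hs.1.le, hs.2⟩
    have hsq : ∫ x, f x s ^ 2 ∂μ ≤ K ^ 2 := by
      rw [← normsq_toLp (h.fM s)]
      exact pow_le_pow_left₀ (norm_nonneg _) hs' 2
    have hfi := (h.fM s).integrable_sq
    rw [Real.norm_of_nonneg (integral_nonneg fun x => norm_nonneg _)]
    calc ∫ x, ‖f x s * η x‖ ∂μ ≤ ∫ x, (f x s ^ 2 + η x ^ 2) / 2 ∂μ := by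
          refine integral_mono (hmul s).norm ((hfi.add hηi).div_const 2) fun x => ?_
          simp only [norm_mul, Real.norm_eq_abs, Pi.add_apply]
          rw [← sq_abs (f x s), ← sq_abs (η x)]
          nlinarith [sq_nonneg (|f x s| - |η x|)]
      _ = ((∫ x, f x s ^ 2 ∂μ) + ∫ x, η x ^ 2 ∂μ) / 2 := by
          rw [integral_div, integral_add hfi hηi]
      _ ≤ _ := by linarith
  simp only [inner_toLp]
  rw [intervalIntegral_integral_swap hint]
  refine integral_congr_ae (ae_of_all _ fun x => ?_)
  have hi : ∀ a b : ℝ, IntervalIntegrable (f x) volume a b := fun a b => (h.fc x).intervalIntegrable _ _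
  have := intervalIntegral.integral_add_adjacent_intervals (hi 0 t1) (hi t1 t2)
  simp only [intervalIntegral.integral_mul_const]
  rw [← this]; ring

theorem l2_zero (h : PSetup μ α T w f) (V : Submodule ℝ ((X → ℝ) × (X → ℝ)))
    (hd : ∀ p ∈ V, ∫ x, p.1 x * p.2 x ∂μ ≤ 0) (hV : ∀ t, (fun x => w x t, fun x => f x t) ∈ V) :
    ∀ t ∈ Icc 0 T, (fun x => w x t) =ᵐ[μ] 0 := by
  let A : Submodule ℝ (Lp ℝ 2 μ × Lp ℝ 2 μ) :=
    { carrier := {P | ∃ p ∈ V, P.1 =ᵐ[μ] p.1 ∧ P.2 =ᵐ[μ] p.2}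
      add_mem' := by
        rintro P Q ⟨p, hp, hp1, hp2⟩ ⟨q, hq, hq1, hq2⟩
        refine ⟨p + q, V.add_mem hp hq, ?_, ?_⟩
        · exact (Lp.coeFn_add P.1 Q.1).trans (hp1.add hq1)
        · exact (Lp.coeFn_add P.2 Q.2).trans (hp2.add hq2)
      zero_mem' := ⟨0, V.zero_mem, Lp.coeFn_zero _ _ _, Lp.coeFn_zero _ _ _⟩
      smul_mem' := by
        rintro c P ⟨p, hp, hp1, hp2⟩
        refine ⟨c • p, V.smul_mem c hp, ?_, ?_⟩
        · exact (Lp.coeFn_smul c P.1).trans (hp1.const_smul c)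
        · exact (Lp.coeFn_smul c P.2).trans (hp2.const_smul c) }
  have hs : HSetup α T (fun t => (h.wM t).toLp _) (fun t => (h.fM t).toLp _) A :=
    { h0 := h.h0
      h1 := h.h1
      hT := h.hT
      wc := h.wH_cont
      w0 := by
        exact toLp_zero' (h.wM 0) h.w0
      f0 := by
        intro t ht
        exact toLp_zero' (h.fM t) fun x => h.f0 x t ht
      fT := by
        intro t ht
        rw [MemLp.toLp_eq_toLp_iff]
        exact ae_of_all _ fun x => h.fT x t ht
      cl := h.cl
      wk := fun t1 t2 K h01 h12 h2T hK η => ⟨h.wkc h12 hK η, h.wki h01 h12 h2T hK η⟩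
      dis := by
        rintro P ⟨p, hp, hp1, hp2⟩
        refine le_trans (le_of_eq ?_) (hd p hp)
        rw [L2.inner_def]
        refine integral_congr_ae ?_
        filter_upwards [hp1, hp2] with x h1 h2
        rw [h1, h2]; simp [mul_comm]
      mem := fun t => ⟨_, hV t, (h.wM t).coeFn_toLp, (h.fM t).coeFn_toLp⟩ }
  intro t ht
  have := hilbert_zero hs t ht
  have h2 := (h.wM t).coeFn_toLp
  rw [this] at h2
  exact h2.symm.trans (Lp.coeFn_zero _ _ _)
end

noncomputable def clampT (T s : ℝ) : ℝ := max 0 (min s T)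

theorem clampT_cont (T : ℝ) : Continuous (clampT T) := by unfold clampT; fun_prop

theorem clampT_mem {T : ℝ} (hT : 0 < T) (s : ℝ) : clampT T s ∈ Icc 0 T :=
  ⟨le_max_left _ _, max_le hT.le (min_le_right _ _)⟩

theorem clampT_of {T s : ℝ} (hs : s ∈ Icc 0 T) : clampT T s = s := by
  unfold clampT; rw [min_eq_left hs.2, max_eq_right hs.1]

theorem clampT_neg {T s : ℝ} (hs : s ≤ 0) : clampT T s = 0 := by
  unfold clampT; exact max_eq_left ((min_le_left _ _).trans hs)

theorem clampT_ge {T s : ℝ} (hT : 0 < T) (hs : T ≤ s) : clampT T s = T := by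
  unfold clampT; rw [min_eq_right hs, max_eq_right hT.le]

noncomputable def qf (T : ℝ) (g : ℝ → ℝ) (s : ℝ) : ℝ := derivWithin g (Icc 0 T) (clampT T s)

noncomputable def Ff (α T : ℝ) (g : ℝ → ℝ) (t : ℝ) : ℝ :=
  ∫ s in (0:ℝ)..t, (t - s) ^ (-α) * qf T g s

theorem qf_cont {T : ℝ} (hT : 0 < T) {g : ℝ → ℝ} (hg : ContDiffOn ℝ 1 g (Icc 0 T)) :
    Continuous (qf T g) :=
  (hg.continuousOn_derivWithin (uniqueDiffOn_Icc hT) le_rfl).comp_continuous (clampT_cont T)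
    (clampT_mem hT)

theorem qf_deriv {T : ℝ} {g : ℝ → ℝ} (hg : ContDiffOn ℝ 1 g (Icc 0 T)) {s : ℝ}
    (hs : s ∈ Ioo 0 T) : HasDerivAt g (qf T g s) s := by
  have hn : Icc 0 T ∈ 𝓝 s := Icc_mem_nhds hs.1 hs.2
  have hd : DifferentiableAt ℝ g s :=
    (hg.differentiableOn (by norm_num) s ⟨hs.1.le, hs.2.le⟩).differentiableAt hn
  rw [qf, clampT_of ⟨hs.1.le, hs.2.le⟩, derivWithin_of_mem_nhds hn]
  exact hd.hasDerivAt

theorem qf_ftc {T : ℝ} (hT : 0 < T) {g : ℝ → ℝ} (hg : ContDiffOn ℝ 1 g (Icc 0 T)) {t : ℝ}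
    (ht : t ∈ Icc 0 T) : ∫ s in (0:ℝ)..t, qf T g s = g t - g 0 := by
  refine intervalIntegral.integral_eq_sub_of_hasDerivAt_of_le ht.1
    (hg.continuousOn.mono (Icc_subset_Icc_right ht.2)) ?_ ((qf_cont hT hg).intervalIntegrable _ _)
  intro x hx
  exact qf_deriv hg ⟨hx.1, hx.2.trans_le ht.2⟩

theorem Ff_caputo {α T : ℝ} {g : ℝ → ℝ} (hg : ContDiffOn ℝ 1 g (Icc 0 T))
    {t : ℝ} (ht : t ∈ Ioc 0 T) (h1 : α < 1) :
    Ff α T g t = Real.Gamma (1 - α) * caputoD α g t := by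
  have hG : Real.Gamma (1 - α) ≠ 0 := (Real.Gamma_pos_of_pos (by linarith)).ne'
  unfold caputoD Ff
  rw [← mul_assoc, mul_one_div_cancel hG, one_mul, intervalIntegral.integral_of_le ht.1.le,
    intervalIntegral.integral_of_le ht.1.le, integral_Ioc_eq_integral_Ioo,
    integral_Ioc_eq_integral_Ioo]
  refine setIntegral_congr_fun measurableSet_Ioo fun s hs => ?_
  have h2 : 0 < t - s := by linarith [hs.2]
  rw [(qf_deriv hg ⟨hs.1, hs.2.trans_le ht.2⟩).deriv, Real.rpow_neg h2.le, div_eq_mul_inv, mul_comm]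

theorem Ff_sub {α T : ℝ} (h1 : α < 1) (hT : 0 < T) {g h : ℝ → ℝ}
    (hg : ContDiffOn ℝ 1 g (Icc 0 T)) (hh : ContDiffOn ℝ 1 h (Icc 0 T)) (t : ℝ) :
    Ff α T (fun s => g s - h s) t = Ff α T g t - Ff α T h t := by
  unfold Ff
  rw [← intervalIntegral.integral_sub (kerq_ii (by linarith) _ _ _ (qf_cont hT hg))
    (kerq_ii (by linarith) _ _ _ (qf_cont hT hh))]
  refine intervalIntegral.integral_congr fun s _ => ?_
  simp only [qf]
  rw [derivWithin_fun_sub (hg.differentiableOn (by norm_num) _ (clampT_mem hT s))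
    (hh.differentiableOn (by norm_num) _ (clampT_mem hT s))]
  ring

theorem Ff_cont {α T : ℝ} (h1 : α < 1) (hT : 0 < T) {g : ℝ → ℝ}
    (hg : ContDiffOn ℝ 1 g (Icc 0 T)) : Continuous (fun t => Ff α T g (clampT T t)) :=
  (fk_cont (by linarith) 0 (qf_cont hT hg)).comp_continuous (clampT_cont T)
    (fun t => (clampT_mem hT t).1)

theorem Ff_idn {α T : ℝ} (h1 : α < 1) (hT : 0 < T) {g : ℝ → ℝ}
    (hg : ContDiffOn ℝ 1 g (Icc 0 T)) (hg0 : g 0 = 0) {t : ℝ} (ht : t ∈ Icc 0 T) :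
    ∫ s in (0:ℝ)..t, (t - s) ^ (-α) * g s = ∫ s in (0:ℝ)..t, Ff α T g s := by
  have hγ : -1 < -α := by linarith
  have a1 := tri (β := -α) (γ := 0) hγ (by norm_num) ht.1 (qf_cont hT hg)
  have a2 := tri (β := 0) (γ := -α) (by norm_num) hγ ht.1 (qf_cont hT hg)
  simp only [Real.rpow_zero, one_mul, mul_one] at a1 a2
  calc _ = ∫ τ in (0:ℝ)..t, (t - τ) ^ (-α) * ∫ s in (0:ℝ)..τ, qf T g s := by
        refine intervalIntegral.integral_congr fun s hs => ?_
        rw [uIcc_of_le ht.1] at hs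
        rw [qf_ftc hT hg ⟨hs.1, hs.2.trans ht.2⟩, hg0, sub_zero]
    _ = _ := a1
    _ = ∫ s in (0:ℝ)..t, qf T g s * ∫ τ in s..t, (τ - s) ^ (-α) := by
        refine intervalIntegral.integral_congr fun s hs => ?_
        rw [ker_int hγ, intervalIntegral.integral_comp_sub_right (fun x => x ^ (-α)) s,
          integral_rpow (Or.inl hγ), sub_self, Real.zero_rpow (by linarith), sub_zero]
    _ = _ := a2.symm

theorem Ff_idn_shift {α T : ℝ} (h1 : α < 1) (hT : 0 < T) {g : ℝ → ℝ}
    (hg : ContDiffOn ℝ 1 g (Icc 0 T)) (hg0 : g 0 = 0) {t : ℝ} (ht : t ∈ Icc 0 (T + 1)) :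
    ∫ s in (0:ℝ)..t, (t - s) ^ (-α) * g (clampT T (s - 1))
      = ∫ s in (0:ℝ)..t, Ff α T g (clampT T (s - 1)) := by
  have hγ : -1 < -α := by linarith
  have hF0 : Ff α T g 0 = 0 := by simp [Ff]
  have z1 : ∀ b ≤ (1:ℝ), 0 ≤ b → ∫ s in (0:ℝ)..b, (t - s) ^ (-α) * g (clampT T (s - 1)) = 0 := by
    intro b hb hb0
    refine intervalIntegral.integral_zero_ae (ae_of_all _ fun s hs => ?_)
    rw [uIoc_of_le hb0] at hs
    rw [clampT_neg (by linarith [hs.2]), hg0, mul_zero]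
  have z2 : ∀ b ≤ (1:ℝ), 0 ≤ b → ∫ s in (0:ℝ)..b, Ff α T g (clampT T (s - 1)) = 0 := by
    intro b hb hb0
    refine intervalIntegral.integral_zero_ae (ae_of_all _ fun s hs => ?_)
    rw [uIoc_of_le hb0] at hs
    rw [clampT_neg (by linarith [hs.2]), hF0]
  rcases le_total t 1 with h | h
  · rw [z1 t h ht.1, z2 t h ht.1]
  have hgc : Continuous fun s => g (clampT T (s - 1)) :=
    (hg.continuousOn.comp_continuous (clampT_cont T) (clampT_mem hT)).comp
      (by fun_prop : Continuous fun s : ℝ => s - 1)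
  have hFc : Continuous fun s => Ff α T g (clampT T (s - 1)) :=
    (Ff_cont h1 hT hg).comp (by fun_prop : Continuous fun s : ℝ => s - 1)
  rw [← intervalIntegral.integral_add_adjacent_intervals (b := 1) (kerq_ii hγ t _ _ hgc)
    (kerq_ii hγ t _ _ hgc), z1 1 le_rfl zero_le_one,
    ← intervalIntegral.integral_add_adjacent_intervals (b := 1) (hFc.intervalIntegrable _ _)
    (hFc.intervalIntegrable _ _), z2 1 le_rfl zero_le_one, zero_add, zero_add]
  have e1 := intervalIntegral.integral_comp_sub_right (a := 1) (b := t)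
    (fun s => (t - 1 - s) ^ (-α) * g (clampT T s)) 1
  have e2 := intervalIntegral.integral_comp_sub_right (a := 1) (b := t)
    (fun s => Ff α T g (clampT T s)) 1
  simp only [sub_sub_sub_cancel_right, sub_self] at e1 e2
  rw [e1, e2]
  have hτ : t - 1 ∈ Icc 0 T := ⟨by linarith, by linarith [ht.2]⟩
  have := Ff_idn h1 hT hg hg0 hτ
  refine Eq.trans ?_ (this.trans ?_)
  · refine intervalIntegral.integral_congr fun s hs => ?_
    rw [uIcc_of_le hτ.1] at hs
    rw [clampT_of ⟨hs.1, hs.2.trans hτ.2⟩]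
  · refine intervalIntegral.integral_congr fun s hs => ?_
    rw [uIcc_of_le hτ.1] at hs
    rw [clampT_of ⟨hs.1, hs.2.trans hτ.2⟩]

structure Good (k m : ℕ) (hk : 0 < k) (L a : Fin (k + m) → ℝ) (B : Matrix (Fin m) (Fin k) ℝ)
    (g : ℕ → Fin (k + m) → ℝ → ℝ) : Prop where
  c : ∀ n ≤ 3, ∀ j, ContinuousOn (g n j) (fclBond k m L j)
  d : ∀ n < 3, ∀ j, ∀ x ∈ fBond k m L j, HasDerivAt (g n j) (g (n + 1) j x) x
  v1 : ∀ j, a j * g 0 j 0 = g 0 (Fin.castAdd m ⟨0, hk⟩) 0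
  v2 : ∀ i : Fin m, g 1 (Fin.natAdd k i) 0 = ∑ j : Fin k, B i j * g 1 (Fin.castAdd m j) 0
  v3 : ∑ j : Fin k, (1 / a (Fin.castAdd m j)) * g 2 (Fin.castAdd m j) 0
    = ∑ i : Fin m, (1 / a (Fin.natAdd k i)) * g 2 (Fin.natAdd k i) 0
  b1 : ∀ j, g 0 j (L j) = 0
  b2 : ∀ j : Fin k, g 1 (Fin.castAdd m j) (L (Fin.castAdd m j)) = 0

theorem ibp {c d : ℝ} (hcd : c ≤ d) {g0 g1 g2 g3 : ℝ → ℝ}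
    (c0 : ContinuousOn g0 (Icc c d)) (c1 : ContinuousOn g1 (Icc c d))
    (c2 : ContinuousOn g2 (Icc c d)) (c3 : ContinuousOn g3 (Icc c d))
    (d0 : ∀ x ∈ Ioo c d, HasDerivAt g0 (g1 x) x) (d1 : ∀ x ∈ Ioo c d, HasDerivAt g1 (g2 x) x)
    (d2 : ∀ x ∈ Ioo c d, HasDerivAt g2 (g3 x) x) :
    ∫ x in Ioo c d, g0 x * g3 x
      = (g0 d * g2 d - g1 d ^ 2 / 2) - (g0 c * g2 c - g1 c ^ 2 / 2) := by
  rw [← integral_Ioc_eq_integral_Ioo, ← intervalIntegral.integral_of_le hcd]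
  refine intervalIntegral.integral_eq_sub_of_hasDerivAt_of_le
    (f := fun x => g0 x * g2 x - g1 x ^ 2 / 2) hcd
    ((c0.mul c2).sub ((c1.pow 2).div_const 2)) ?_ ?_
  · intro x hx
    have := ((d0 x hx).mul (d2 x hx)).sub (((d1 x hx).pow 2).div_const 2)
    refine this.congr_deriv ?_
    simp; ring
  · refine ContinuousOn.intervalIntegrable ?_
    rw [uIcc_of_le hcd]
    exact c0.mul c3

section
variable {k m : ℕ} {hk : 0 < k} {L a : Fin (k + m) → ℝ} {B : Matrix (Fin m) (Fin k) ℝ}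

theorem fcl_in (j : Fin k) : fclBond k m L (Fin.castAdd m j) = Icc (L (Fin.castAdd m j)) 0 := by
  simp [fclBond]
theorem fb_in (j : Fin k) : fBond k m L (Fin.castAdd m j) = Ioo (L (Fin.castAdd m j)) 0 := by
  simp [fBond]
theorem fcl_out (j : Fin m) : fclBond k m L (Fin.natAdd k j) = Icc 0 (L (Fin.natAdd k j)) := by
  simp [fclBond]
theorem fb_out (j : Fin m) : fBond k m L (Fin.natAdd k j) = Ioo 0 (L (Fin.natAdd k j)) := by
  simp [fBond]

theorem good_dis (hLneg : ∀ j : Fin (k + m), (j : ℕ) < k → L j < 0)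
    (hLpos : ∀ j : Fin (k + m), k ≤ (j : ℕ) → 0 < L j) (ha : ∀ j, a j ≠ 0)
    (hB : ((1 : Matrix (Fin k) (Fin k) ℝ) - B.transpose * B).PosDef)
    {g : ℕ → Fin (k + m) → ℝ → ℝ} (hg : Good k m hk L a B g) :
    ∑ j, ∫ x in fBond k m L j, g 0 j x * g 3 j x ≤ 0 := by
  rw [Fin.sum_univ_add]
  have hin : ∀ j : Fin k, ∫ x in fBond k m L (Fin.castAdd m j),
      g 0 (Fin.castAdd m j) x * g 3 (Fin.castAdd m j) x
      = g 0 (Fin.castAdd m j) 0 * g 2 (Fin.castAdd m j) 0 - g 1 (Fin.castAdd m j) 0 ^ 2 / 2 := by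
    intro j
    have hc := fun n hn => hg.c n hn (Fin.castAdd m j)
    have hd := fun n hn => hg.d n hn (Fin.castAdd m j)
    rw [fcl_in] at hc
    rw [fb_in] at hd ⊢
    rw [ibp (hLneg _ (by simp)).le (hc 0 (by norm_num)) (hc 1 (by norm_num)) (hc 2 (by norm_num))
      (hc 3 (by norm_num)) (hd 0 (by norm_num)) (hd 1 (by norm_num)) (hd 2 (by norm_num)),
      hg.b1, hg.b2]
    ring
  have hout : ∀ j : Fin m, ∫ x in fBond k m L (Fin.natAdd k j),
      g 0 (Fin.natAdd k j) x * g 3 (Fin.natAdd k j) x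
      ≤ - (g 0 (Fin.natAdd k j) 0 * g 2 (Fin.natAdd k j) 0) + g 1 (Fin.natAdd k j) 0 ^ 2 / 2 := by
    intro j
    have hc := fun n hn => hg.c n hn (Fin.natAdd k j)
    have hd := fun n hn => hg.d n hn (Fin.natAdd k j)
    rw [fcl_out] at hc
    rw [fb_out] at hd ⊢
    rw [ibp (hLpos _ (by simp)).le (hc 0 (by norm_num)) (hc 1 (by norm_num)) (hc 2 (by norm_num))
      (hc 3 (by norm_num)) (hd 0 (by norm_num)) (hd 1 (by norm_num)) (hd 2 (by norm_num)),
      hg.b1]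
    nlinarith [sq_nonneg (g 1 (Fin.natAdd k j) (L (Fin.natAdd k j)))]
  have h0 : ∀ j, g 0 j 0 = g 0 (Fin.castAdd m ⟨0, hk⟩) 0 * (1 / a j) := by
    intro j
    rw [← hg.v1 j]; field_simp [ha j]
  have hmat : ∑ i : Fin m, g 1 (Fin.natAdd k i) 0 ^ 2 ≤ ∑ j : Fin k, g 1 (Fin.castAdd m j) 0 ^ 2 := by
    have := hB.posSemidef.dotProduct_mulVec_nonneg (fun j : Fin k => g 1 (Fin.castAdd m j) 0)
    rw [Matrix.sub_mulVec, Matrix.one_mulVec, dotProduct_sub, ← Matrix.mulVec_mulVec,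
      Matrix.dotProduct_mulVec, Matrix.vecMul_transpose] at this
    simp only [dotProduct, star_trivial, Matrix.mulVec, ← hg.v2] at this
    simp only [sq]
    linarith
  have hs := Finset.sum_le_sum (s := Finset.univ) fun j _ => hout j
  rw [Finset.sum_congr rfl fun j _ => hin j, Finset.sum_sub_distrib]
  rw [Finset.sum_add_distrib, Finset.sum_neg_distrib] at hs
  have e1 : ∑ j : Fin k, g 0 (Fin.castAdd m j) 0 * g 2 (Fin.castAdd m j) 0
      = ∑ j : Fin m, g 0 (Fin.natAdd k j) 0 * g 2 (Fin.natAdd k j) 0 := by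
    have := congrArg (fun z => g 0 (Fin.castAdd m ⟨0, hk⟩) 0 * z) hg.v3
    simp only [Finset.mul_sum, ← mul_assoc, ← h0] at this
    exact this
  rw [← Finset.sum_div] at hs ⊢
  linarith

theorem Good.zero : Good k m hk L a B (fun _ _ _ => 0) where
  c := fun _ _ _ => continuousOn_const
  d := fun _ _ _ x _ => hasDerivAt_const x 0
  v1 := by simp
  v2 := by simp
  v3 := by simp
  b1 := by simp
  b2 := by simp

theorem Good.lin {g h : ℕ → Fin (k + m) → ℝ → ℝ} (hg : Good k m hk L a B g)
    (hh : Good k m hk L a B h) (r : ℝ) : Good k m hk L a B (fun n j x => g n j x + r * h n j x) where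
  c := fun n hn j => (hg.c n hn j).add (continuousOn_const.mul (hh.c n hn j))
  d := fun n hn j x hx => (hg.d n hn j x hx).add ((hh.d n hn j x hx).const_mul r)
  v1 := fun j => by rw [← hg.v1 j, ← hh.v1 j]; ring
  v2 := fun i => by
    rw [hg.v2 i, hh.v2 i, Finset.mul_sum, ← Finset.sum_add_distrib]
    exact Finset.sum_congr rfl fun j _ => by ring
  v3 := by
    have e : ∀ {n : ℕ} (A G Q : Fin n → ℝ), ∑ j, A j * (G j + r * Q j)
        = ∑ j, A j * G j + r * ∑ j, A j * Q j := by
      intro n A G Q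
      rw [Finset.mul_sum, ← Finset.sum_add_distrib]
      exact Finset.sum_congr rfl fun j _ => by ring
    rw [e, e, hg.v3, hh.v3]
  b1 := fun j => by rw [hg.b1, hh.b1]; ring
  b2 := fun j => by rw [hg.b2, hh.b2]; ring

/-- submodule of admissible pairs -/
def Vsub (hk : 0 < k) (L a : Fin (k + m) → ℝ) (B : Matrix (Fin m) (Fin k) ℝ) (c : ℝ) :
    Submodule ℝ ((Fin (k + m) × ℝ → ℝ) × (Fin (k + m) × ℝ → ℝ)) where
  carrier := {p | ∃ g, Good k m hk L a B g ∧ ∀ j, ∀ x ∈ fBond k m L j,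
    p.1 (j, x) = g 0 j x ∧ p.2 (j, x) = c * g 3 j x}
  add_mem' := by
    rintro p q ⟨g, hg, hp⟩ ⟨h, hh, hq⟩
    refine ⟨_, hg.lin hh 1, fun j x hx => ?_⟩
    have := hp j x hx
    have := hq j x hx
    simp_all [mul_add]
  zero_mem' := ⟨_, Good.zero, fun j x hx => by simp⟩
  smul_mem' := by
    rintro r p ⟨g, hg, hp⟩
    refine ⟨_, Good.zero.lin hg r, fun j x hx => ?_⟩
    have := hp j x hx
    simp_all [mul_left_comm]

/-- the measure on the graph -/
noncomputable def gmeas (k m : ℕ) (L : Fin (k + m) → ℝ) : Measure (Fin (k + m) × ℝ) :=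
  ∑ j, (volume.restrict (fBond k m L j)).map (Prod.mk j)

theorem fb_meas (j : Fin (k + m)) : MeasurableSet (fBond k m L j) := by
  unfold fBond; split_ifs <;> exact measurableSet_Ioo

theorem fb_sub (j : Fin (k + m)) : fBond k m L j ⊆ fclBond k m L j := by
  unfold fBond fclBond; split_ifs <;> exact Ioo_subset_Icc_self

theorem fcl_compact (j : Fin (k + m)) : IsCompact (fclBond k m L j) := by
  unfold fclBond; split_ifs <;> exact isCompact_Icc

instance fb_fin (j : Fin (k + m)) : IsFiniteMeasure (volume.restrict (fBond k m L j)) := by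
  unfold fBond; split_ifs <;> infer_instance

instance gmeas_fin : IsFiniteMeasure (gmeas k m L) := by
  unfold gmeas; infer_instance

theorem gmeas_ae {p : Fin (k + m) × ℝ → Prop} (h : ∀ᵐ x ∂(gmeas k m L), p x) (j : Fin (k + m)) :
    ∀ᵐ x ∂(volume.restrict (fBond k m L j)), p (j, x) := by
  rw [gmeas, ← Measure.sum_fintype, Measure.ae_sum_iff] at h
  exact (measurableEmbedding_prodMk_left j).ae_map_iff.1 (h j)

theorem Vsub_dis (hLneg : ∀ j : Fin (k + m), (j : ℕ) < k → L j < 0)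
    (hLpos : ∀ j : Fin (k + m), k ≤ (j : ℕ) → 0 < L j) (ha : ∀ j, a j ≠ 0)
    (hB : ((1 : Matrix (Fin k) (Fin k) ℝ) - B.transpose * B).PosDef) {c : ℝ} (hc : 0 ≤ c) :
    ∀ p ∈ Vsub hk L a B c, ∫ x, p.1 x * p.2 x ∂(gmeas k m L) ≤ 0 := by
  rintro p ⟨g, hg, hp⟩
  have hemb := fun j : Fin (k + m) => measurableEmbedding_prodMk_left (β := ℝ) j
  have hcg : ∀ j, ContinuousOn (fun x => c * (g 0 j x * g 3 j x)) (fclBond k m L j) := fun j =>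
    continuousOn_const.mul ((hg.c 0 (by norm_num) j).mul (hg.c 3 le_rfl j))
  have heq : ∀ j, ∀ x ∈ fBond k m L j, p.1 (j, x) * p.2 (j, x) = c * (g 0 j x * g 3 j x) := by
    intro j x hx
    rw [(hp j x hx).1, (hp j x hx).2]; ring
  rw [gmeas, integral_finsetSum_measure]
  · have : ∀ j, ∫ x, p.1 x * p.2 x ∂(volume.restrict (fBond k m L j)).map (Prod.mk j)
        = c * ∫ x in fBond k m L j, g 0 j x * g 3 j x := by
      intro j
      rw [(hemb j).integral_map, ← integral_const_mul]
      exact setIntegral_congr_fun (fb_meas j) (heq j)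
    rw [Finset.sum_congr rfl fun j _ => this j, ← Finset.mul_sum]
    exact mul_nonpos_of_nonneg_of_nonpos hc (good_dis hLneg hLpos ha hB hg)
  · intro j _
    rw [(hemb j).integrable_map_iff]
    have : IntegrableOn (fun x => c * (g 0 j x * g 3 j x)) (fBond k m L j) :=
      ((hcg j).integrableOn_compact (fcl_compact j)).mono_set (fb_sub j)
    exact this.congr_fun (fun x hx => (heq j x hx).symm) (fb_meas j)
end

theorem itd_hasDeriv {c d : ℝ} (hcd : c < d) {g : ℝ → ℝ} (hg : ContDiffOn ℝ 3 g (Icc c d)) {n : ℕ}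
    (hn : n < 3) {x : ℝ} (hx : x ∈ Ioo c d) :
    HasDerivAt (iteratedDerivWithin n g (Icc c d)) (iteratedDerivWithin (n + 1) g (Icc c d) x) x := by
  have hN : Icc c d ∈ 𝓝 x := Icc_mem_nhds hx.1 hx.2
  have := (hg.differentiableOn_iteratedDerivWithin (m := n) (by exact_mod_cast hn)
    (uniqueDiffOn_Icc hcd) x ⟨hx.1.le, hx.2.le⟩)
  rw [iteratedDerivWithin_succ]
  exact this.hasDerivWithinAt.hasDerivAt hN

theorem itd_three {c d : ℝ} (g : ℝ → ℝ) {x : ℝ} (hx : x ∈ Ioo c d) :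
    iteratedDerivWithin 3 g (Icc c d) x = deriv (deriv (deriv g)) x := by
  have hN : (Icc c d : Set ℝ) =ᶠ[𝓝 x] univ := eventuallyEq_univ.2 (Icc_mem_nhds hx.1 hx.2)
  have : iteratedDerivWithin 3 g (Icc c d) x = iteratedDerivWithin 3 g univ x := by
    simp only [iteratedDerivWithin]
    rw [iteratedFDerivWithin_congr_set hN]
  rw [this, iteratedDerivWithin_univ]
  simp [iteratedDeriv_succ]

/-- **Theorem 3.** If `BᵀB - I_k` is negative definite, the initial-boundary value
problem for the time-fractional Airy equation on the star graph with finite bonds has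
at most one classical solution. -/
theorem uniqueness_ibvp_time_fractional_airy_star_graph
    (k m : ℕ) (hk : 0 < k) (hm : 0 < m) (α T : ℝ) (hα0 : 0 < α) (hα1 : α < 1)
    (hT : 0 < T) (L : Fin (k + m) → ℝ)
    (hLneg : ∀ j : Fin (k + m), (j : ℕ) < k → L j < 0)
    (hLpos : ∀ j : Fin (k + m), k ≤ (j : ℕ) → 0 < L j)
    (a : Fin (k + m) → ℝ) (ha1 : a (Fin.castAdd m ⟨0, hk⟩) = 1) (ha : ∀ j, a j ≠ 0)
    (B : Matrix (Fin m) (Fin k) ℝ)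
    (hB : ((1 : Matrix (Fin k) (Fin k) ℝ) - B.transpose * B).PosDef)
    (u0 : Fin (k + m) → ℝ → ℝ) (f : Fin (k + m) → ℝ → ℝ → ℝ)
    (φ : Fin (k + m) → ℝ → ℝ) (ψ : Fin k → ℝ → ℝ)
    (u v : Fin (k + m) → ℝ → ℝ → ℝ)
    (hu : IsClassicalSol k m T L u) (hv : IsClassicalSol k m T L v)
    (hus : SolvesIBVP k m hk α T L a B u0 f φ ψ u)
    (hvs : SolvesIBVP k m hk α T L a B u0 f φ ψ v) :
    ∀ j, ∀ x ∈ fclBond k m L j, ∀ t ∈ Set.Icc 0 T, u j x t = v j x t := by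
  classical
  let W : Fin (k + m) → ℝ → ℝ → ℝ := fun j x s => u j x s - v j x s
  have hWt : ∀ j, ∀ x ∈ fclBond k m L j, ContDiffOn ℝ 1 (W j x) (Icc 0 T) := fun j x hx =>
    (hu.smooth_t j x hx).sub (hv.smooth_t j x hx)
  have hW0 : ∀ j, ∀ x ∈ fclBond k m L j, W j x 0 = 0 := fun j x hx => by
    simp only [W]; rw [hus.init j x hx, hvs.init j x hx, sub_self]
  have hWc : ∀ j, ContinuousOn (fun p : ℝ × ℝ => W j p.1 p.2) (fclBond k m L j ×ˢ Icc 0 T) :=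
    fun j => (hu.cont j).sub (hv.cont j)
  have hWx : ∀ j, ∀ t ∈ Icc 0 T, ContinuousOn (fun x => W j x t) (fclBond k m L j) := by
    intro j t ht
    exact (hWc j).comp (f := fun x => (x, t)) (by fun_prop) fun x hx => ⟨hx, ht⟩
  have hbond : ∀ j, ∃ c d, c < d ∧ fclBond k m L j = Icc c d ∧ fBond k m L j = Ioo c d := by
    intro j
    by_cases hj : (j : ℕ) < k
    · exact ⟨L j, 0, hLneg j hj, by simp [fclBond, hj], by simp [fBond, hj]⟩
    · exact ⟨0, L j, hLpos j (not_lt.1 hj), by simp [fclBond, hj], by simp [fBond, hj]⟩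
  let G : ℝ → ℕ → Fin (k + m) → ℝ → ℝ := fun t n j x =>
    iteratedDerivWithin n (fun y => u j y t) (fclBond k m L j) x
      - iteratedDerivWithin n (fun y => v j y t) (fclBond k m L j) x
  have hGood : ∀ t ∈ Ioc 0 T, Good k m hk L a B (G t) := by
    intro t ht
    refine ⟨?_, ?_, ?_, ?_, ?_, ?_, ?_⟩
    · intro n hn j
      obtain ⟨c, d, hcd, h1, h2⟩ := hbond j
      have q1 := hu.smooth_x j t ht
      have q2 := hv.smooth_x j t ht
      simp only [G]
      rw [h1] at q1 q2 ⊢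
      exact (q1.continuousOn_iteratedDerivWithin (by exact_mod_cast hn) (uniqueDiffOn_Icc hcd)).sub
        (q2.continuousOn_iteratedDerivWithin (by exact_mod_cast hn) (uniqueDiffOn_Icc hcd))
    · intro n hn j x hx
      obtain ⟨c, d, hcd, h1, h2⟩ := hbond j
      have q1 := hu.smooth_x j t ht
      have q2 := hv.smooth_x j t ht
      simp only [G]
      rw [h1] at q1 q2 ⊢
      rw [h2] at hx
      exact (itd_hasDeriv hcd q1 hn hx).sub (itd_hasDeriv hcd q2 hn hx)
    · intro j
      simp only [G, iteratedDerivWithin_zero]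
      rw [← hus.vertex1 t ht j, ← hvs.vertex1 t ht j]; ring
    · intro i
      simp only [G, iteratedDerivWithin_one]
      rw [hus.vertex2 t ht i, hvs.vertex2 t ht i, ← Finset.sum_sub_distrib]
      exact Finset.sum_congr rfl fun j _ => by ring
    · simp only [G, mul_sub, Finset.sum_sub_distrib]
      rw [hus.vertex3 t ht, hvs.vertex3 t ht]
    · intro j
      simp only [G, iteratedDerivWithin_zero]
      rw [hus.bdry1 t ht j, hvs.bdry1 t ht j, sub_self]
    · intro j
      simp only [G, iteratedDerivWithin_one]
      rw [hus.bdry2 t ht j, hvs.bdry2 t ht j, sub_self]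
  have hFG : ∀ t ∈ Ioc 0 T, ∀ j, ∀ x ∈ fBond k m L j,
      Ff α T (W j x) t = Real.Gamma (1 - α) * G t 3 j x := by
    intro t ht j x hx
    have e1 := hus.eqn j x hx t ht
    have e2 := hvs.eqn j x hx t ht
    have hx' := fb_sub j hx
    obtain ⟨c, d, hcd, h1, h2⟩ := hbond j
    simp only [W, G]
    rw [Ff_sub hα1 hT (hu.smooth_t j x hx') (hv.smooth_t j x hx'),
      Ff_caputo (hu.smooth_t j x hx') ht hα1, Ff_caputo (hv.smooth_t j x hx') ht hα1, h1]
    rw [h2] at hx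
    rw [itd_three _ hx, itd_three _ hx]
    have : caputoD α (fun s => u j x s) t - caputoD α (fun s => v j x s) t
      = deriv (deriv (deriv (fun y => u j y t))) x - deriv (deriv (deriv (fun y => v j y t))) x := by
      linarith
    rw [← this]; ring
  have hF0 : ∀ j x, Ff α T (W j x) 0 = 0 := fun j x => by simp [Ff]
  let w : Fin (k + m) × ℝ → ℝ → ℝ := fun p t =>
    if p.2 ∈ fBond k m L p.1 then W p.1 p.2 (clampT T (t - 1)) else 0
  let F : Fin (k + m) × ℝ → ℝ → ℝ := fun p t =>
    if p.2 ∈ fBond k m L p.1 then Ff α T (W p.1 p.2) (clampT T (t - 1)) else 0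
  have hshift : Continuous fun s : ℝ => s - 1 := by fun_prop
  have hcl : ∀ t, clampT T (t - 1) = 0 ∨ clampT T (t - 1) ∈ Ioc 0 T := by
    intro t
    have := clampT_mem hT (t - 1)
    rcases this.1.eq_or_lt with h | h
    · exact Or.inl h.symm
    · exact Or.inr ⟨h, this.2⟩
  have hwb : ∃ M, ∀ x t, |w x t| ≤ M := by
    have : ∀ j, ∃ M, ∀ p ∈ fclBond k m L j ×ˢ Icc 0 T, ‖W j p.1 p.2‖ ≤ M := fun j =>
      ((fcl_compact j).prod isCompact_Icc).exists_bound_of_continuousOn (hWc j)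
    choose M hM using this
    refine ⟨∑ j, |M j|, fun p t => ?_⟩
    simp only [w]
    split_ifs with h
    · refine (hM p.1 (p.2, clampT T (t - 1)) ⟨fb_sub _ h, clampT_mem hT _⟩).trans
        ((le_abs_self _).trans ?_)
      exact Finset.single_le_sum (f := fun j => |M j|) (fun j _ => abs_nonneg _) (Finset.mem_univ _)
    · rw [abs_zero]; exact Finset.sum_nonneg fun j _ => abs_nonneg _
  have hFb : ∀ t, ∃ M, ∀ x, |F x t| ≤ M := by
    intro t
    rcases hcl t with h0 | ht
    · refine ⟨0, fun p => ?_⟩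
      simp only [F, h0, hF0]; simp
    have : ∀ j, ∃ M, ∀ x ∈ fclBond k m L j, ‖G (clampT T (t - 1)) 3 j x‖ ≤ M := fun j =>
      (fcl_compact j).exists_bound_of_continuousOn ((hGood _ ht).c 3 le_rfl j)
    choose M hM using this
    refine ⟨∑ j, |Real.Gamma (1 - α)| * |M j|, fun p => ?_⟩
    simp only [F]
    split_ifs with h
    · rw [hFG _ ht _ _ h, abs_mul]
      refine (mul_le_mul_of_nonneg_left ((hM p.1 p.2 (fb_sub _ h)).trans
        (le_abs_self _)) (abs_nonneg _)).trans ?_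
      exact Finset.single_le_sum (f := fun j => |Real.Gamma (1 - α)| * |M j|)
        (fun j _ => by positivity) (Finset.mem_univ _)
    · rw [abs_zero]; exact Finset.sum_nonneg fun j _ => by positivity
  have hP : PSetup (gmeas k m L) α (T + 1) w F :=
    { h0 := hα0
      h1 := hα1
      hT := by linarith
      wc := by
        intro p
        by_cases h : p.2 ∈ fBond k m L p.1
        · simp only [w, if_pos h]
          exact ((hWt p.1 p.2 (fb_sub _ h)).continuousOn.comp_continuous (clampT_cont T)
            (clampT_mem hT)).comp hshift
        · simp only [w, if_neg h]; exact continuous_const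
      fc := by
        intro p
        by_cases h : p.2 ∈ fBond k m L p.1
        · simp only [F, if_pos h]
          exact (Ff_cont hα1 hT (hWt p.1 p.2 (fb_sub _ h))).comp hshift
        · simp only [F, if_neg h]; exact continuous_const
      wm := by
        intro t
        refine measurable_from_prod_countable_right fun j => ?_
        exact ContinuousOn.measurable_piecewise (f := fun x => W j x (clampT T (t - 1)))
          (g := fun _ => 0) (s := fBond k m L j)
          ((hWx j _ (clampT_mem hT _)).mono (fb_sub j)) continuousOn_const (fb_meas j)
      fm := by
        intro t
        refine measurable_from_prod_countable_right fun j => ?_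
        refine ContinuousOn.measurable_piecewise
          (f := fun x => Ff α T (W j x) (clampT T (t - 1)))
          (g := fun _ => 0) (s := fBond k m L j) ?_ continuousOn_const (fb_meas j)
        rcases hcl t with h0 | ht
        · simp only [h0, hF0]; exact continuousOn_const
        · have : ContinuousOn (fun x => Real.Gamma (1 - α) * G (clampT T (t - 1)) 3 j x)
              (fBond k m L j) :=
            continuousOn_const.mul (((hGood _ ht).c 3 le_rfl j).mono (fb_sub j))
          exact this.congr fun x hx => hFG _ ht j x hx
      wb := hwb
      fb := hFb
      w0 := by
        intro p
        simp only [w]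
        split_ifs with h
        · rw [clampT_neg (by norm_num)]; exact hW0 _ _ (fb_sub _ h)
        · rfl
      f0 := by
        intro p t ht
        simp only [F]
        rw [clampT_neg (by linarith), hF0, ite_self]
      fT := by
        intro p t ht
        simp only [F]
        rw [clampT_ge hT (by linarith), clampT_ge hT (by linarith)]
      idn := by
        intro p t ht
        by_cases h : p.2 ∈ fBond k m L p.1
        · simp only [w, F, if_pos h]
          exact Ff_idn_shift hα1 hT (hWt _ _ (fb_sub _ h)) (hW0 _ _ (fb_sub _ h)) ht
        · simp only [w, F, if_neg h]; simp }
  have hGam : 0 < Real.Gamma (1 - α) := Real.Gamma_pos_of_pos (by linarith)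
  have hz := l2_zero hP (Vsub hk L a B (Real.Gamma (1 - α)))
    (Vsub_dis hLneg hLpos ha hB hGam.le) (by
      intro t
      rcases hcl t with h0 | ht
      · refine ⟨_, Good.zero, fun j x hx => ?_⟩
        simp only [w, F, if_pos hx, h0, hF0, mul_zero]
        exact ⟨hW0 _ _ (fb_sub _ hx), trivial⟩
      · refine ⟨_, hGood _ ht, fun j x hx => ?_⟩
        simp only [w, F, if_pos hx]
        refine ⟨?_, hFG _ ht j x hx⟩
        simp only [G, iteratedDerivWithin_zero, W])
  intro j x hx t ht
  have h1 := gmeas_ae (hz (t + 1) ⟨by linarith [ht.1], by linarith [ht.2]⟩) j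
  obtain ⟨c, d, hcd, hcl1, hop⟩ := hbond j
  have h2 : (fun x => W j x t) =ᵐ[volume.restrict (fBond k m L j)] fun _ => 0 := by
    filter_upwards [h1, ae_restrict_mem (fb_meas j)] with y hy hyb
    simp only [w, if_pos hyb, add_sub_cancel_right, clampT_of ht, Pi.zero_apply] at hy
    exact hy
  have h3 : EqOn (fun x => W j x t) (fun _ => 0) (fBond k m L j) := by
    have hcc := (hWx j t ht).mono (fb_sub j)
    rw [hop] at h2 hcc ⊢
    exact Measure.eqOn_open_of_ae_eq h2 isOpen_Ioo hcc continuousOn_const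
  have h4 : EqOn (fun x => W j x t) (fun _ => 0) (fclBond k m L j) := by
    refine h3.of_subset_closure (hWx j t ht) continuousOn_const (fb_sub j) ?_
    rw [hcl1, hop, closure_Ioo hcd.ne]
  have := h4 hx
  simp only [W] at this
  linarith
end

section
/- Let 0<λ<1, μ∈ℂ, and let a∈ℂ∖{0} satisfy (1+λ)π/2 < |arg a| ≤ π. Then z ↦ φ(−λ,μ;az) is integrable on (0,+∞) and ∫₀^{+∞} φ(−λ,μ;az) dz = −1/(a·Γ(μ+λ)). -/
open MeasureTheory Real Filter Set Topology

/-- Integrand of the Hankel integral in logarithmic coordinates. -/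
noncomputable def hg (w ζ : ℂ) : ℂ := Complex.exp (Complex.exp ζ + (1 - w) * ζ)

structure Adm (m : Measure ℝ) (γ : ℝ → ℂ) : Prop where
  cont : Continuous γ
  bd : ∀ᵐ t ∂m, 0 ≤ (γ t).re ∧ |(γ t).im| ≤ π
  int : ∀ M A l : ℝ, l < 1 → Integrable (fun t => rexp ((Complex.exp (γ t)).re + M * (γ t).re
    + A * rexp (l * (γ t).re))) m

lemma hg_norm (w ζ : ℂ) : ‖hg w ζ‖ =
    rexp ((Complex.exp ζ).re + (1 - w.re) * ζ.re + w.im * ζ.im) := by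
  rw [hg, Complex.norm_exp]
  congr 1
  simp [Complex.add_re, Complex.mul_re]
  ring

lemma hg_bound (w ζ : ℂ) (h0 : 0 ≤ ζ.re) (h1 : |ζ.im| ≤ π) (M : ℝ) (hM : 1 - w.re ≤ M) :
    ‖hg w ζ‖ ≤ rexp (|w.im| * π) * rexp ((Complex.exp ζ).re + M * ζ.re) := by
  rw [hg_norm, ← Real.exp_add]
  apply Real.exp_le_exp.2
  have a1 : w.im * ζ.im ≤ |w.im| * π := by
    calc w.im * ζ.im ≤ |w.im * ζ.im| := le_abs_self _
      _ = |w.im| * |ζ.im| := abs_mul _ _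
      _ ≤ _ := by gcongr
  have a2 : (1 - w.re) * ζ.re ≤ M * ζ.re := by gcongr
  linarith

lemma hg_cont (w : ℂ) : Continuous (hg w) := by unfold hg; fun_prop

lemma Adm.int' {m : Measure ℝ} {γ : ℝ → ℂ} (h : Adm m γ) (M : ℝ) :
    Integrable (fun t => rexp ((Complex.exp (γ t)).re + M * (γ t).re)) m := by
  simpa using h.int M 0 0 one_pos

lemma Adm.integrable {m : Measure ℝ} {γ : ℝ → ℂ} (h : Adm m γ) (w : ℂ) :
    Integrable (fun t => hg w (γ t)) m := by
  refine ((h.int' (1 - w.re)).const_mul (rexp (|w.im| * π))).mono'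
    ((hg_cont w).comp h.cont).aestronglyMeasurable ?_
  filter_upwards [h.bd] with t ht
  exact hg_bound w _ ht.1 ht.2 _ le_rfl

lemma Adm.hasSum {m : Measure ℝ} {γ : ℝ → ℂ} (h : Adm m γ) (l : ℝ) (hl : l < 1) (w z : ℂ) :
    HasSum (fun n : ℕ => z ^ n / (n.factorial : ℂ) * ∫ t, hg (-(l : ℂ) * n + w) (γ t) ∂m)
      (∫ t, hg w (γ t) * Complex.exp (z * Complex.exp (l * γ t)) ∂m) := by
  have key : ∀ (n : ℕ) (ζ : ℂ), z ^ n / (n.factorial : ℂ) * hg (-(l : ℂ) * n + w) ζ =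
      hg w ζ * ((z * Complex.exp (l * ζ)) ^ n / (n.factorial : ℂ)) := by
    intro n ζ
    have : hg (-(l : ℂ) * n + w) ζ = hg w ζ * Complex.exp (l * ζ) ^ n := by
      unfold hg
      rw [← Complex.exp_nat_mul, ← Complex.exp_add]
      congr 1; ring
    rw [this, mul_pow]; ring
  simp_rw [← integral_const_mul, key]
  have hs : ∀ x : ℝ, HasSum (fun n : ℕ => x ^ n / (n.factorial : ℝ)) (rexp x) := by
    intro x
    rw [Real.exp_eq_exp_ℝ]; exact NormedSpace.expSeries_div_hasSum_exp x
  have hn : ∀ t, ‖z * Complex.exp (l * γ t)‖ = ‖z‖ * rexp (l * (γ t).re) := by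
    intro t
    rw [norm_mul, Complex.norm_exp]; simp
  refine hasSum_integral_of_dominated_convergence
    (fun n t => ‖hg w (γ t)‖ * (‖z * Complex.exp (l * γ t)‖ ^ n / (n.factorial : ℝ))) ?_ ?_ ?_ ?_ ?_
  · intro n
    have := (hg_cont w).comp h.cont
    have h2 := h.cont
    apply Continuous.aestronglyMeasurable
    simp only [Function.comp_def] at this
    fun_prop
  · intro n
    refine ae_of_all _ fun t => ?_
    rw [norm_mul, norm_div, norm_pow]
    simp
  · exact ae_of_all _ fun t => ((hs _).mul_left _).summable
  · have : ∀ t, ∑' n : ℕ, ‖hg w (γ t)‖ * (‖z * Complex.exp (l * γ t)‖ ^ n / (n.factorial : ℝ))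
        = ‖hg w (γ t)‖ * rexp (‖z‖ * rexp (l * (γ t).re)) := by
      intro t
      rw [((hs _).mul_left _).tsum_eq, hn]
    simp_rw [this]
    refine ((h.int (1 - w.re) ‖z‖ l hl).const_mul (rexp (|w.im| * π))).mono' ?_ ?_
    · have := (hg_cont w).comp h.cont
      have h2 := h.cont
      apply Continuous.aestronglyMeasurable
      simp only [Function.comp_def] at this
      fun_prop
    · filter_upwards [h.bd] with t ht
      have := hg_bound w _ ht.1 ht.2 _ le_rfl
      rw [norm_mul, norm_norm, Real.norm_of_nonneg (Real.exp_pos _).le, Real.exp_add (_ + _),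
        ← mul_assoc]
      gcongr
  · refine ae_of_all _ fun t => HasSum.mul_left _ ?_
    rw [Complex.exp_eq_exp_ℂ]; exact NormedSpace.expSeries_div_hasSum_exp _

lemma Adm.ray {m : Measure ℝ} [SFinite m] {γ : ℝ → ℂ} (h : Adm m γ) (l : ℝ) (w a : ℂ) (ha : a ≠ 0)
    (δ : ℝ) (hδ : 0 < δ) (hd : ∀ᵐ t ∂m, (a * Complex.exp (l * γ t)).re ≤ - δ) :
    IntegrableOn (fun r : ℝ => ∫ t, hg w (γ t) * Complex.exp (a * r * Complex.exp (l * γ t)) ∂m)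
      (Ioi 0) ∧
    ∫ r in Ioi (0:ℝ), (∫ t, hg w (γ t) * Complex.exp (a * r * Complex.exp (l * γ t)) ∂m) =
      -1 / a * ∫ t, hg (w + l) (γ t) ∂m := by
  have hE : IntegrableOn (fun r : ℝ => rexp (-δ * r)) (Ioi 0) :=
    integrableOn_exp_mul_Ioi (by linarith) 0
  have hI : Integrable (Function.uncurry fun (r : ℝ) (t : ℝ) =>
      hg w (γ t) * Complex.exp (a * r * Complex.exp (l * γ t)))
      ((volume.restrict (Ioi 0)).prod m) := by
    have hm := hE.mul_prod (h.integrable w).norm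
    refine hm.mono' ?_ ?_
    · have := hg_cont w
      have h2 := h.cont
      apply Continuous.aestronglyMeasurable
      unfold Function.uncurry
      fun_prop
    · have e1 : ∀ᵐ p ∂((volume.restrict (Ioi (0:ℝ))).prod m), p.1 ∈ Ioi (0:ℝ) :=
        Measure.quasiMeasurePreserving_fst.ae (ae_restrict_mem measurableSet_Ioi)
      have e2 : ∀ᵐ p ∂((volume.restrict (Ioi (0:ℝ))).prod m),
          (a * Complex.exp (l * γ p.2)).re ≤ - δ :=
        Measure.quasiMeasurePreserving_snd.ae hd
      filter_upwards [e1, e2] with p h1 h2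
      simp only [Function.uncurry]
      rw [norm_mul, Complex.norm_exp, mul_comm]
      have : (a * p.1 * Complex.exp (l * γ p.2)).re = p.1 * (a * Complex.exp (l * γ p.2)).re := by
        rw [mul_right_comm, mul_comm, Complex.re_ofReal_mul]
      rw [this]
      have h1' : 0 < p.1 := h1
      exact mul_le_mul_of_nonneg_right (Real.exp_le_exp.2 (by nlinarith)) (norm_nonneg _)
  refine ⟨hI.integral_prod_left, ?_⟩
  rw [integral_integral_swap hI, ← integral_const_mul]
  apply integral_congr_ae
  filter_upwards [hd] with t ht
  rw [integral_const_mul]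
  have : ∀ r : ℝ, a * r * Complex.exp (l * γ t) = (a * Complex.exp (l * γ t)) * r := by
    intro r; ring
  simp_rw [this]
  rw [integral_exp_mul_complex_Ioi (by linarith)]
  have : hg (w + l) (γ t) = hg w (γ t) * (Complex.exp (l * γ t))⁻¹ := by
    unfold hg
    rw [← Complex.exp_neg, ← Complex.exp_add]; congr 1; ring
  rw [this]
  have := Complex.exp_ne_zero (l * γ t)
  simp
  field_simp

lemma Adm.diff {m : Measure ℝ} {γ : ℝ → ℂ} (h : Adm m γ) :
    Differentiable ℂ (fun w => ∫ t, hg w (γ t) ∂m) := by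
  intro w
  have hc := h.cont
  have hg' : ∀ w, Continuous fun t => hg w (γ t) := fun w => (hg_cont w).comp h.cont
  refine (hasDerivAt_integral_of_dominated_loc_of_deriv_le (F' := fun w t => hg w (γ t) * (-γ t))
    (bound := fun t => rexp ((|w.im| + 1) * π) * rexp π *
      rexp ((Complex.exp (γ t)).re + (3 - w.re) * (γ t).re))
    (Metric.ball_mem_nhds w one_pos) ?_ (h.integrable w) ?_ ?_ ?_ ?_).2.differentiableAt
  · exact Eventually.of_forall fun x => (hg' x).aestronglyMeasurable
  · exact ((hg' w).mul hc.neg).aestronglyMeasurable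
  · filter_upwards [h.bd] with t ht x hx
    rw [Metric.mem_ball, Complex.dist_eq] at hx
    have r1 : |x.re - w.re| < 1 := by
      simpa using (Complex.abs_re_le_norm (x - w)).trans_lt hx
    have r2 : |x.im - w.im| < 1 := by
      simpa using (Complex.abs_im_le_norm (x - w)).trans_lt hx
    have r3 : |x.im| ≤ |w.im| + 1 := by
      have := abs_add_le (x.im - w.im) w.im
      simp at this; linarith
    have b := hg_bound x (γ t) ht.1 ht.2 (2 - w.re) (by linarith [(abs_lt.1 r1).1])
    rw [norm_mul, norm_neg]
    have n1 : ‖γ t‖ ≤ rexp π * rexp ((γ t).re) := by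
      have h1 := Complex.norm_le_abs_re_add_abs_im (γ t)
      rw [abs_of_nonneg ht.1] at h1
      have h2 := Real.add_one_le_exp (π + (γ t).re)
      rw [← Real.exp_add]
      linarith [ht.2]
    calc _ ≤ (rexp (|x.im| * π) * rexp ((Complex.exp (γ t)).re + (2 - w.re) * (γ t).re)) *
          (rexp π * rexp ((γ t).re)) := by gcongr
      _ = rexp (|x.im| * π) * rexp π * rexp ((Complex.exp (γ t)).re + (3 - w.re) * (γ t).re) := by
        have : (Complex.exp (γ t)).re + (3 - w.re) * (γ t).re =
          ((Complex.exp (γ t)).re + (2 - w.re) * (γ t).re) + (γ t).re := by ring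
        rw [this, Real.exp_add (_ + _)]; ring
      _ ≤ _ := by gcongr
  · exact (h.int' _).const_mul _
  · refine ae_of_all _ fun t x _ => ?_
    have : HasDerivAt (fun x : ℂ => Complex.exp (γ t) + (1 - x) * γ t) (-γ t) x := by
      simpa using (((hasDerivAt_id x).const_sub 1).mul_const (γ t)).const_add (Complex.exp (γ t))
    exact this.cexp

lemma evt_bound (κ : ℝ) (hκ : 0 < κ) (M A l : ℝ) (hl : l < 1) :
    ∀ᶠ x : ℝ in atTop, -κ * rexp x + M * x + A * rexp (l * x) ≤ -x := by
  have h1 : (fun x : ℝ => (M + 1) * x) =o[atTop] rexp := by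
    have := (isLittleO_pow_exp_atTop (n := 1)).const_mul_left (M + 1)
    simpa using this
  have h2 : (fun x : ℝ => A * rexp (l * x)) =o[atTop] rexp := by
    refine Asymptotics.IsLittleO.const_mul_left ?_ A
    rw [Real.isLittleO_exp_comp_exp_comp]
    have : (fun x : ℝ => x - l * x) = fun x => (1 - l) * x := by ext; ring
    rw [this]
    exact tendsto_id.const_mul_atTop (by linarith)
  have h3 := (h1.add h2).def hκ
  filter_upwards [h3] with x hx
  rw [Real.norm_of_nonneg (Real.exp_pos x).le] at hx
  have := (le_abs_self _).trans hx
  linarith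

lemma exp_line_re (x y : ℝ) : (Complex.exp (x + y * Complex.I)).re = rexp x * Real.cos y := by
  rw [Complex.exp_re]; simp

lemma adm_line (y : ℝ) (hy : |y| ≤ π) (hc : Real.cos y < 0) :
    Adm (volume.restrict (Ioi 0)) (fun x : ℝ => (x : ℂ) + y * Complex.I) where
  cont := by fun_prop
  bd := by
    filter_upwards [ae_restrict_mem measurableSet_Ioi] with t ht
    have : (0:ℝ) < t := ht
    simp [this.le, hy]
  int := by
    intro M A l hl
    refine integrable_of_isBigO_exp_neg (b := 1) one_pos ?_ ?_
    · apply Continuous.continuousOn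
      fun_prop
    · apply Asymptotics.IsBigO.of_bound 1
      filter_upwards [evt_bound (-Real.cos y) (by linarith) M A l hl] with x hx
      rw [Real.norm_of_nonneg (Real.exp_pos _).le, Real.norm_of_nonneg (Real.exp_pos _).le, one_mul]
      apply Real.exp_le_exp.2
      rw [exp_line_re]
      simp
      linarith

lemma adm_arc (ψ : ℝ) (h1 : ψ ≤ π) :
    Adm (volume.restrict (Ioc (-ψ) ψ)) (fun y : ℝ => (y : ℂ) * Complex.I) where
  cont := by fun_prop
  bd := by
    filter_upwards [ae_restrict_mem measurableSet_Ioc] with t ht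
    simp
    rw [abs_le]; constructor <;> linarith [ht.1, ht.2]
  int := by
    intro M A l hl
    apply Continuous.integrableOn_Ioc
    fun_prop

lemma hg_diff (w : ℂ) : Differentiable ℂ (hg w) := by unfold hg; fun_prop

lemma right_strip (w : ℂ) (p q κ : ℝ) (hpq : p ≤ q) (hκ : 0 < κ)
    (hb : ∀ y ∈ Icc p q, |y| ≤ π ∧ Real.cos y ≤ -κ) :
    (∫ x in Ioi (0:ℝ), hg w (x + p * Complex.I)) - (∫ x in Ioi (0:ℝ), hg w (x + q * Complex.I))
      - Complex.I * ∫ y in p..q, hg w (y * Complex.I) = 0 := by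
  have hp := hb p ⟨le_rfl, hpq⟩
  have hq := hb q ⟨hpq, le_rfl⟩
  have ip := (adm_line p hp.1 (by linarith)).integrable w
  have iq := (adm_line q hq.1 (by linarith)).integrable w
  have tp := intervalIntegral_tendsto_integral_Ioi (0:ℝ) ip tendsto_id
  have tq := intervalIntegral_tendsto_integral_Ioi (0:ℝ) iq tendsto_id
  have tv : Tendsto (fun R : ℝ => ∫ y in p..q, hg w (R + y * Complex.I)) atTop (𝓝 0) := by
    have hb' : Tendsto (fun R : ℝ => rexp (|w.im| * π) * rexp (-R) * |q - p|) atTop (𝓝 0) := by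
      have := (Real.tendsto_exp_neg_atTop_nhds_zero.const_mul (rexp (|w.im| * π))).mul_const |q - p|
      simpa using this
    refine squeeze_zero_norm' ?_ hb'
    filter_upwards [evt_bound κ hκ (1 - w.re) 0 0 one_pos, eventually_ge_atTop 0] with R hR hR0
    apply intervalIntegral.norm_integral_le_of_norm_le_const
    intro y hy
    rw [uIoc_of_le hpq] at hy
    obtain ⟨y1, y2⟩ := hb y ⟨hy.1.le, hy.2⟩
    refine (hg_bound w _ (by simpa using hR0) (by simpa using y1) _ le_rfl).trans ?_
    gcongr
    rw [exp_line_re]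
    simp at hR ⊢
    nlinarith [Real.exp_pos R]
  have tot := ((tp.sub tq).add (tv.const_mul Complex.I)).sub_const
    (Complex.I * ∫ y in p..q, hg w (y * Complex.I))
  rw [mul_zero, add_zero] at tot
  refine tendsto_nhds_unique tot ?_
  refine Tendsto.congr (fun R => ?_) tendsto_const_nhds
  have := Complex.integral_boundary_rect_eq_zero_of_differentiableOn (hg w) (p * Complex.I)
    (R + q * Complex.I) (hg_diff w).differentiableOn
  simp at this
  simp
  exact this.symm

lemma hg_bound_left (w : ℂ) (x y : ℝ) (hx : x ≤ 0) (hy : |y| ≤ π) :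
    ‖hg w (x + y * Complex.I)‖ ≤ rexp (1 + |w.im| * π) * rexp ((1 - w.re) * x) := by
  rw [hg_norm, ← Real.exp_add]
  apply Real.exp_le_exp.2
  rw [exp_line_re]
  simp
  have a1 : w.im * y ≤ |w.im| * π := by
    calc w.im * y ≤ |w.im * y| := le_abs_self _
      _ = |w.im| * |y| := abs_mul _ _
      _ ≤ _ := by gcongr
  have a2 := Real.exp_le_one_iff.2 hx
  nlinarith [Real.exp_pos x, Real.cos_le_one y]

lemma int_left (w : ℂ) (hw : w.re < 1) (y : ℝ) (hy : |y| ≤ π) :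
    IntegrableOn (fun x : ℝ => hg w (x + y * Complex.I)) (Iic 0) := by
  have := (integrableOn_exp_mul_Iic (a := 1 - w.re) (by linarith) 0).const_mul (rexp (1 + |w.im| * π))
  refine Integrable.mono' this ?_ ?_
  · apply Continuous.aestronglyMeasurable
    have := hg_cont w
    fun_prop
  · filter_upwards [ae_restrict_mem measurableSet_Iic] with t ht
    exact hg_bound_left w t y ht hy

lemma left_strip (w : ℂ) (hw : w.re < 1) :
    (∫ x in Iic (0:ℝ), hg w (x + (-π : ℝ) * Complex.I))
      - (∫ x in Iic (0:ℝ), hg w (x + π * Complex.I))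
      + Complex.I * ∫ y in (-π)..π, hg w (y * Complex.I) = 0 := by
  have ip := int_left w hw (-π) (by simp [abs_of_pos pi_pos])
  have iq := int_left w hw π (by simp [abs_of_pos pi_pos])
  have tp := intervalIntegral_tendsto_integral_Iic (0:ℝ) ip tendsto_neg_atTop_atBot
  have tq := intervalIntegral_tendsto_integral_Iic (0:ℝ) iq tendsto_neg_atTop_atBot
  have tv : Tendsto (fun R : ℝ => ∫ y in (-π)..π, hg w ((-R : ℝ) + y * Complex.I)) atTop (𝓝 0) := by
    have hb' : Tendsto (fun R : ℝ => rexp (1 + |w.im| * π) * rexp ((1 - w.re) * (-R)) * |π - (-π)|)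
        atTop (𝓝 0) := by
      have h1 : Tendsto (fun R : ℝ => rexp ((1 - w.re) * (-R))) atTop (𝓝 0) :=
        Real.tendsto_exp_atBot.comp (tendsto_neg_atTop_atBot.const_mul_atBot (by linarith))
      have := (h1.const_mul (rexp (1 + |w.im| * π))).mul_const |π - (-π)|
      simpa using this
    refine squeeze_zero_norm' ?_ hb'
    filter_upwards [eventually_ge_atTop 0] with R hR0
    apply intervalIntegral.norm_integral_le_of_norm_le_const
    intro y hy
    rw [uIoc_of_le (by linarith [pi_pos])] at hy
    exact hg_bound_left w _ y (by linarith) (abs_le.2 ⟨hy.1.le, hy.2⟩)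
  have tot := ((tp.sub tq).add_const
    (Complex.I * ∫ y in (-π)..π, hg w (y * Complex.I))).sub (tv.const_mul Complex.I)
  rw [mul_zero, sub_zero] at tot
  refine tendsto_nhds_unique tot ?_
  refine Tendsto.congr (fun R => ?_) tendsto_const_nhds
  have := Complex.integral_boundary_rect_eq_zero_of_differentiableOn (hg w)
    ((-R : ℝ) + (-π : ℝ) * Complex.I)
    (π * Complex.I) (hg_diff w).differentiableOn
  simp at this
  simp
  exact this.symm

lemma gamma_line (v : ℂ) (hv : 0 < v.re) :
    ∫ x : ℝ, Complex.exp (-Complex.exp x + v * x) = Complex.Gamma v := by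
  rw [Complex.Gamma_eq_integral hv, Complex.GammaIntegral]
  have := integral_image_eq_integral_abs_deriv_smul (s := univ) (f := rexp) (f' := rexp)
    MeasurableSet.univ (fun x _ => (Real.hasDerivAt_exp x).hasDerivWithinAt)
    (Real.exp_injective.injOn) (fun x : ℝ => ((-x).exp : ℂ) * (x : ℂ) ^ (v - 1))
  rw [image_univ, Real.range_exp] at this
  rw [this, Measure.restrict_univ]
  congr 1
  ext x
  rw [abs_of_pos (Real.exp_pos x), Complex.real_smul,
    Complex.cpow_def_of_ne_zero (by exact_mod_cast (Real.exp_pos x).ne'), ← Complex.ofReal_log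
    (Real.exp_pos x).le, Real.log_exp]
  push_cast
  rw [← Complex.exp_add, ← Complex.exp_add]
  congr 1; ring

/-- Hankel's contour functional. -/
noncomputable def hK (ψ : ℝ) (f : ℂ → ℂ) : ℂ :=
  (∫ x in Ioi (0:ℝ), f (x + ψ * Complex.I)) - (∫ x in Ioi (0:ℝ), f (x + (-ψ : ℝ) * Complex.I))
    + Complex.I * ∫ y in Ioc (-ψ) ψ, f (y * Complex.I)

lemma hK_pi (w : ℂ) (hw : w.re < 1) :
    hK π (hg w) = 2 * π * Complex.I * (Complex.Gamma w)⁻¹ := by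
  have hπ : |π| ≤ π := by simp [abs_of_pos pi_pos]
  have hπ' : |-π| ≤ π := by simp [abs_of_pos pi_pos]
  have ls := left_strip w hw
  have full : ∀ y : ℝ, |y| ≤ π → Real.cos y < 0 →
      (∫ x in Iic (0:ℝ), hg w (x + y * Complex.I)) + (∫ x in Ioi (0:ℝ), hg w (x + y * Complex.I))
      = ∫ x : ℝ, hg w (x + y * Complex.I) := by
    intro y h1 h2
    exact intervalIntegral.integral_Iic_add_Ioi (int_left w hw y h1) ((adm_line y h1 h2).integrable w)
  have f1 := full π hπ (by simp)
  have f2 := full (-π) hπ' (by simp)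
  have v1 : ∫ x : ℝ, hg w (x + π * Complex.I) =
      Complex.exp ((1 - w) * (π * Complex.I)) * Complex.Gamma (1 - w) := by
    rw [← gamma_line (1 - w) (by simpa using hw), ← integral_const_mul]
    congr 1; ext x
    unfold hg
    rw [← Complex.exp_add, Complex.exp_add (x : ℂ), Complex.exp_pi_mul_I]
    congr 1; ring
  have v2 : ∫ x : ℝ, hg w (x + (-π : ℝ) * Complex.I) =
      Complex.exp (-((1 - w) * (π * Complex.I))) * Complex.Gamma (1 - w) := by
    rw [← gamma_line (1 - w) (by simpa using hw), ← integral_const_mul]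
    congr 1; ext x
    unfold hg
    rw [← Complex.exp_add, Complex.exp_add (x : ℂ)]
    have : Complex.exp (((-π : ℝ) : ℂ) * Complex.I) = -1 := by
      push_cast; rw [neg_mul, Complex.exp_neg, Complex.exp_pi_mul_I]; norm_num
    rw [this]
    congr 1; push_cast; ring
  rw [v1] at f1
  rw [v2] at f2
  have e1 : hK π (hg w) = (Complex.exp ((1 - w) * (π * Complex.I)) -
      Complex.exp (-((1 - w) * (π * Complex.I)))) * Complex.Gamma (1 - w) := by
    unfold hK
    rw [← intervalIntegral.integral_of_le (by linarith [pi_pos])]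
    linear_combination ls + f1 - f2
  have e2 : Complex.exp ((1 - w) * (π * Complex.I)) -
      Complex.exp (-((1 - w) * (π * Complex.I))) = 2 * Complex.I * Complex.sin (π * (1 - w)) := by
    rw [Complex.sin]
    have : -(↑π * (1 - w)) * Complex.I = -((1 - w) * (π * Complex.I)) := by ring
    rw [this]
    have : (↑π * (1 - w)) * Complex.I = ((1 - w) * (π * Complex.I)) := by ring
    rw [this]
    linear_combination (Complex.exp ((1 - w) * (π * Complex.I)) -
      Complex.exp (-((1 - w) * (π * Complex.I)))) * (Complex.I_sq)
  rw [e1, e2]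
  have e3 : Complex.sin (π * (1 - w)) = Complex.sin (π * w) := by
    rw [mul_sub, mul_one, Complex.sin_pi_sub]
  have hG : Complex.Gamma (1 - w) ≠ 0 := Complex.Gamma_ne_zero_of_re_pos (by simpa using hw)
  have hr := Complex.Gamma_mul_Gamma_one_sub w
  rw [e3]
  by_cases hs : Complex.sin (π * w) = 0
  · rw [hs, div_zero] at hr
    have : Complex.Gamma w = 0 := by simpa [hG] using hr
    rw [this, hs]; simp
  · have hG' : Complex.Gamma w ≠ 0 := by
      intro h0
      rw [h0, zero_mul] at hr
      have : (π : ℂ) ≠ 0 := by exact_mod_cast pi_ne_zero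
      exact div_ne_zero this hs hr.symm
    rw [eq_div_iff hs] at hr
    field_simp
    linear_combination hr

lemma hK_indep (w : ℂ) (ψ : ℝ) (h1 : π / 2 < ψ) (h2 : ψ ≤ π) : hK ψ (hg w) = hK π (hg w) := by
  have hc : Real.cos ψ < 0 := Real.cos_neg_of_pi_div_two_lt_of_lt h1 (by linarith [pi_pos])
  have cb : ∀ y ∈ Icc ψ π, Real.cos y ≤ Real.cos ψ := fun y hy =>
    Real.cos_le_cos_of_nonneg_of_le_pi (by linarith [pi_pos]) hy.2 hy.1
  have r1 := right_strip w ψ π (-Real.cos ψ) h2 (by linarith) (fun y hy =>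
    ⟨by rw [abs_of_nonneg (by linarith [pi_pos, hy.1])]; exact hy.2, by linarith [cb y hy]⟩)
  have r2 := right_strip w (-π) (-ψ) (-Real.cos ψ) (by linarith) (by linarith) (fun y hy =>
    ⟨by rw [abs_of_nonpos (by linarith [pi_pos, hy.2])]; linarith [hy.1],
     by rw [← Real.cos_neg y]; linarith [cb (-y) ⟨by linarith [hy.2], by linarith [hy.1]⟩]⟩)
  have hc' : Continuous fun y : ℝ => hg w (y * Complex.I) := by
    have := hg_cont w
    fun_prop
  have a1 := intervalIntegral.integral_add_adjacent_intervals (hc'.intervalIntegrable (μ := volume) (-π) (-ψ))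
    (hc'.intervalIntegrable (-ψ) ψ)
  have a2 := intervalIntegral.integral_add_adjacent_intervals (hc'.intervalIntegrable (μ := volume) (-π) ψ)
    (hc'.intervalIntegrable ψ π)
  unfold hK
  rw [← intervalIntegral.integral_of_le (by linarith [pi_pos]),
    ← intervalIntegral.integral_of_le (by linarith [pi_pos])]
  linear_combination r1 + r2 - Complex.I * (-(a1 + a2))

lemma hK_hankel (ψ : ℝ) (h1 : π / 2 < ψ) (h2 : ψ ≤ π) (w : ℂ) :
    hK ψ (hg w) = 2 * π * Complex.I * (Complex.Gamma w)⁻¹ := by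
  have hc : Real.cos ψ < 0 := Real.cos_neg_of_pi_div_two_lt_of_lt h1 (by linarith [pi_pos])
  have hψ : |ψ| ≤ π := by rw [abs_of_nonneg (by linarith [pi_pos])]; exact h2
  have d1 : Differentiable ℂ (fun w => hK ψ (hg w)) :=
    ((adm_line ψ hψ hc).diff.sub (adm_line (-ψ) (by simpa using hψ) (by simpa using hc)).diff).add
      ((adm_arc ψ h2).diff.const_mul Complex.I)
  have d2 : Differentiable ℂ (fun w => 2 * π * Complex.I * (Complex.Gamma w)⁻¹) :=
    Complex.differentiable_one_div_Gamma.const_mul _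
  have := AnalyticOnNhd.eq_of_eventuallyEq (f := fun w => hK ψ (hg w))
    (g := fun w => 2 * π * Complex.I * (Complex.Gamma w)⁻¹) (z₀ := 0)
    (Complex.analyticOnNhd_univ_iff_differentiable.2 d1)
    (Complex.analyticOnNhd_univ_iff_differentiable.2 d2) (by
      have : ∀ᶠ w : ℂ in 𝓝 0, w.re < 1 :=
        (Complex.continuous_re.tendsto 0).eventually (gt_mem_nhds (by simp))
      filter_upwards [this] with w hw
      rw [hK_indep w ψ h1 h2, hK_pi w hw])
  exact congrFun this w

lemma cos_bound (lam α ψ : ℝ) (hl : 0 < lam) (h1 : lam * ψ < |α| - π / 2) (h2 : |α| ≤ π)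
    (y : ℝ) (hy : |y| ≤ ψ) :
    Real.cos (α + lam * y) ≤ - Real.sin (|α| - π / 2 - lam * ψ) := by
  have core : ∀ β y : ℝ, 0 ≤ β → β ≤ π → lam * ψ < β - π / 2 → |y| ≤ ψ →
      Real.cos (β + lam * y) ≤ - Real.sin (β - π / 2 - lam * ψ) := by
    intro β y b0 b1 b2 hy
    have hy' := abs_le.1 hy
    have e : Real.cos (β + lam * y) = - Real.cos |β + lam * y - π| := by
      rw [Real.cos_abs, Real.cos_sub_pi, neg_neg]
    have e2 : Real.sin (β - π / 2 - lam * ψ) = Real.cos (π - (β - lam * ψ)) := by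
      rw [← Real.cos_pi_div_two_sub]; congr 1; ring
    rw [e, e2, neg_le_neg_iff]
    have k1 : lam * y ≤ lam * ψ := by gcongr; exact hy'.2
    have k2 : -(lam * ψ) ≤ lam * y := by
      have := mul_le_mul_of_nonneg_left hy'.1 hl.le
      linarith
    apply Real.cos_le_cos_of_nonneg_of_le_pi (abs_nonneg _) (by nlinarith [pi_pos, abs_nonneg y])
    rw [abs_le]
    constructor <;> linarith
  rcases le_or_gt 0 α with h | h
  · rw [abs_of_nonneg h] at *
    exact core α y h h2 h1 hy
  · have := core |α| (-y) (abs_nonneg _) h2 h1 (by simpa using hy)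
    rw [abs_of_neg h] at *
    rw [← Real.cos_neg]
    convert this using 2
    ring

lemma re_bound (lam : ℝ) (hl : 0 < lam) (a ζ : ℂ) (s : ℝ) (hs : 0 < s)
    (hc : Real.cos (a.arg + lam * ζ.im) ≤ -s) (h0 : 0 ≤ ζ.re) :
    (a * Complex.exp (lam * ζ)).re ≤ -(‖a‖ * s) := by
  have e : a * Complex.exp (lam * ζ) =
      (‖a‖ : ℂ) * Complex.exp (((lam * ζ.re : ℝ) : ℂ) + ((a.arg + lam * ζ.im : ℝ) : ℂ) * Complex.I) := by
    conv_lhs => rw [← Complex.norm_mul_exp_arg_mul_I a]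
    rw [mul_assoc, ← Complex.exp_add]
    congr 2
    conv_lhs => rw [← Complex.re_add_im ζ]
    push_cast; ring
  rw [e, Complex.re_ofReal_mul, exp_line_re, ← mul_neg]
  have h1 : 1 ≤ rexp (lam * ζ.re) := Real.one_le_exp (by positivity)
  gcongr
  nlinarith

/-- The integral formula `∫₀^∞ φ(−λ, μ; a z) dz = −1/(a Γ(μ+λ))` for `0 < λ < 1` and a
ray direction `a ≠ 0` with `(1+λ)π/2 < |arg a| ≤ π`. -/
theorem wrightPhi_ray_integral
    (lam : ℝ) (hlam0 : 0 < lam) (hlam1 : lam < 1) (μ : ℂ) (a : ℂ) (ha : a ≠ 0)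
    (harg : (1 + lam) * Real.pi / 2 < |a.arg|) (harg' : |a.arg| ≤ Real.pi) :
    MeasureTheory.IntegrableOn
      (fun z : ℝ => wrightPhi (-(lam : ℂ)) μ (a * z)) (Set.Ioi 0) ∧
    (∫ z in Set.Ioi (0:ℝ), wrightPhi (-(lam : ℂ)) μ (a * z)) =
      -1 / (a * Complex.Gamma (μ + lam)) := by
  have hπ := pi_pos
  obtain ⟨ψ, hψ1, hψ2⟩ : ∃ ψ, π / 2 < ψ ∧ ψ < min π ((|a.arg| - π / 2) / lam) := by
    apply exists_between
    rw [lt_min_iff]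
    refine ⟨by linarith, ?_⟩
    rw [lt_div_iff₀ hlam0]
    linarith
  rw [lt_min_iff, lt_div_iff₀ hlam0] at hψ2
  obtain ⟨hψ2, hψ3⟩ := hψ2
  have hc : Real.cos ψ < 0 := Real.cos_neg_of_pi_div_two_lt_of_lt hψ1 (by linarith [pi_pos])
  have hψ : |ψ| ≤ π := by rw [abs_of_nonneg (by linarith [pi_pos])]; exact hψ2.le
  have A1 := adm_line ψ hψ hc
  have A2 := adm_line (-ψ) (by simpa using hψ) (by simpa using hc)
  have A3 := adm_arc ψ hψ2.le
  set s := Real.sin (|a.arg| - π / 2 - lam * ψ) with hs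
  have hspos : 0 < s := Real.sin_pos_of_pos_of_lt_pi (by linarith) (by nlinarith)
  have hna : 0 < ‖a‖ := norm_pos_iff.2 ha
  have hδ : 0 < ‖a‖ * s := by positivity
  have cosb := cos_bound lam a.arg ψ hlam0 (by linarith) harg'
  have hψ0 : 0 ≤ ψ := by linarith
  have R1 := A1.ray lam μ a ha _ hδ (by
    filter_upwards [A1.bd] with t ht
    exact re_bound lam hlam0 a _ s hspos (cosb _ (by simp [abs_of_nonneg hψ0])) ht.1)
  have R2 := A2.ray lam μ a ha _ hδ (by
    filter_upwards [A2.bd] with t ht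
    exact re_bound lam hlam0 a _ s hspos (cosb _ (by simp [abs_of_nonneg hψ0])) ht.1)
  have R3 := A3.ray lam μ a ha _ hδ (by
    filter_upwards [A3.bd, ae_restrict_mem measurableSet_Ioc] with t ht ht'
    exact re_bound lam hlam0 a _ s hspos (cosb _ (by simpa using abs_le.2 ⟨ht'.1.le, ht'.2⟩)) ht.1)
  have h2pi : (2 * π * Complex.I : ℂ) ≠ 0 := by
    simp [pi_ne_zero]
  have rep : ∀ z : ℂ, wrightPhi (-(lam : ℂ)) μ z = (2 * π * Complex.I)⁻¹ *
      hK ψ (fun ζ => hg μ ζ * Complex.exp (z * Complex.exp (lam * ζ))) := by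
    intro z
    have S := (((A1.hasSum lam hlam1 μ z).sub (A2.hasSum lam hlam1 μ z)).add
      ((A3.hasSum lam hlam1 μ z).mul_left Complex.I)).mul_left (2 * π * Complex.I : ℂ)⁻¹
    unfold wrightPhi hK
    rw [← S.tsum_eq]
    congr 1; ext n
    have H := hK_hankel ψ hψ1 hψ2.le (-(lam : ℂ) * n + μ)
    have H' : (Complex.Gamma (-(lam : ℂ) * n + μ))⁻¹ =
      (2 * π * Complex.I)⁻¹ * hK ψ (hg (-(lam : ℂ) * n + μ)) := by
      rw [H, inv_mul_cancel_left₀ h2pi]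
    rw [div_mul_eq_div_mul_one_div, one_div, H']
    unfold hK
    ring
  simp_rw [rep]
  have I3 := R3.1.const_mul Complex.I
  refine ⟨((R1.1.sub R2.1).add I3).const_mul _, ?_⟩
  rw [integral_const_mul]
  unfold hK
  have J1 := integral_add (R1.1.sub R2.1) I3
  have J2 := integral_sub R1.1 R2.1
  have J3 := integral_const_mul (μ := volume.restrict (Ioi (0:ℝ))) Complex.I (fun r : ℝ => ∫ t in Ioc (-ψ) ψ, hg μ (t * Complex.I) *
    Complex.exp (a * r * Complex.exp (lam * (t * Complex.I))))
  simp only [Pi.sub_apply] at J1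
  rw [J1, J2, J3, R1.2, R2.2, R3.2]
  have H := hK_hankel ψ hψ1 hψ2.le (μ + lam)
  have H' : (Complex.Gamma (μ + lam))⁻¹ =
      (2 * π * Complex.I)⁻¹ * hK ψ (hg (μ + lam)) := by
      rw [H, inv_mul_cancel_left₀ h2pi]
  rw [div_mul_eq_div_mul_one_div, one_div, H']
  unfold hK
  ring
end
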